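/- arXiv:2103.06918 — 6 statements merged into one kernel-verified Lean document; each statement's English description precedes it below -/
import Mathlib

section
/- For all integers k ≥ 3 and n ≥ 1, the number of permutations of length n avoiding the set A_k equals n times the number of permutations of length n-1 avoiding the increasing pattern 12⋯(k-1); that is, av_n(A_k) = n · av_{n-1}(12⋯(k-1)). -/
/-- A permutation `p` of length `n` contains the pattern `q` of length `k` if there
are positions `i₁ < i₂ < ⋯ < i_k` whose entries are order-isomorphic to `q`. -/
def Contains {n k : ℕ} (p : Equiv.Perm (Fin n)) (q : Equiv.Perm (Fin k)) : Prop :=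
  ∃ f : Fin k → Fin n, StrictMono f ∧ ∀ r s : Fin k, q r < q s ↔ p (f r) < p (f s)

/-- `p` avoids every pattern in the set `S` of patterns of length `k`. -/
def AvoidsSet {n k : ℕ} (p : Equiv.Perm (Fin n)) (S : Set (Equiv.Perm (Fin k))) : Prop :=
  ∀ q ∈ S, ¬ Contains p q

/-- `A_k`: the set of patterns of length `k` whose first `k-1` entries are increasing. -/
def Ak (k : ℕ) : Set (Equiv.Perm (Fin k)) :=
  { q | ∀ r s : Fin k, (r : ℕ) < (s : ℕ) → (s : ℕ) < k - 1 → q r < q s }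

/-- `A_{k,i}`: the set `A_k` with the pattern ending in `i` removed (entries of patterns
are thought of as `1`-indexed values `1,…,k`, so value `i` corresponds to `i-1 : Fin k`). -/
def Aki (k i : ℕ) : Set (Equiv.Perm (Fin k)) :=
  { q ∈ Ak k | ∀ j : Fin k, (j : ℕ) = k - 1 → (q j : ℕ) ≠ i - 1 }

/-- The number of permutations of length `n` avoiding the set of patterns `S`. -/
noncomputable def avSet (n : ℕ) {k : ℕ} (S : Set (Equiv.Perm (Fin k))) : ℕ :=
  Nat.card { p : Equiv.Perm (Fin n) // AvoidsSet p S }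

/-- The number of permutations of length `n` avoiding the single pattern `q`. -/
noncomputable def avPat (n : ℕ) {k : ℕ} (q : Equiv.Perm (Fin k)) : ℕ :=
  Nat.card { p : Equiv.Perm (Fin n) // ¬ Contains p q }

/-- The rank of the entry in position `j` of `p`: the length of the longest increasing
subsequence of `p` ending in `p j`. -/
noncomputable def rank {n : ℕ} (p : Equiv.Perm (Fin n)) (j : Fin n) : ℕ :=
  sSup { m : ℕ | ∃ f : Fin m → Fin n, StrictMono f ∧ StrictMono (p ∘ f) ∧
    (∀ r, f r ≤ j) ∧ (∃ r, f r = j) }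

/-- The permutation of length `m+1` with last entry `v` whose first `m` entries
are order-isomorphic to `σ`. -/
def glue {m : ℕ} (x : Fin (m + 1) × Equiv.Perm (Fin m)) : Equiv.Perm (Fin (m + 1)) :=
  ((finSuccEquiv' (Fin.last m)).trans (Equiv.optionCongr x.2)).trans (finSuccEquiv' x.1).symm

theorem glue_last {m : ℕ} (x : Fin (m + 1) × Equiv.Perm (Fin m)) :
    glue x (Fin.last m) = x.1 := by
  simp [glue]

theorem glue_castSucc {m : ℕ} (x : Fin (m + 1) × Equiv.Perm (Fin m)) (i : Fin m) :
    glue x i.castSucc = x.1.succAbove (x.2 i) := by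
  have h : finSuccEquiv' (Fin.last m) i.castSucc = some i := by
    rw [← Fin.succAbove_last, finSuccEquiv'_succAbove]
  simp [glue, h]

theorem glue_bijective (m : ℕ) : Function.Bijective (@glue m) := by
  rw [Fintype.bijective_iff_injective_and_card]
  constructor
  · rintro ⟨v, σ⟩ ⟨w, τ⟩ h
    have h1 : v = w := by
      have := congrArg (fun p => p (Fin.last m)) h
      simpa only [glue_last] using this
    subst h1
    have h2 : σ = τ := by
      ext1 i
      have := congrArg (fun p => p i.castSucc) h
      simp only [glue_castSucc] at this
      exact Fin.succAbove_right_injective this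
    rw [h2]
  · simp [Fintype.card_perm, Nat.factorial_succ]

theorem exists_standard {K N : ℕ} (h : Fin K → Fin N) (hh : Function.Injective h) :
    ∃ q : Equiv.Perm (Fin K), ∀ r s, q r < q s ↔ h r < h s := by
  have hm : StrictMono (h ∘ Tuple.sort h) :=
    (Tuple.monotone_sort h).strictMono_of_injective (hh.comp (Tuple.sort h).injective)
  refine ⟨(Tuple.sort h).symm, fun r s => ?_⟩
  rw [← hm.lt_iff_lt]
  simp

theorem avoids_glue {m j : ℕ} (x : Fin (m + 1) × Equiv.Perm (Fin m)) :
    AvoidsSet (glue x) (Ak (j + 1)) ↔ ¬ Contains x.2 (Equiv.refl (Fin j)) := by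
  constructor
  · rintro hA ⟨f, hf, hp⟩
    let g : Fin (j + 1) → Fin (m + 1) :=
      Fin.snoc (α := fun _ => Fin (m + 1)) (fun i => (f i).castSucc) (Fin.last m)
    have g1 : ∀ i : Fin j, g i.castSucc = (f i).castSucc := fun i => by simp [g]
    have g2 : g (Fin.last j) = Fin.last m := by simp [g]
    have hg : StrictMono g := by
      intro r s hrs
      induction s using Fin.lastCases with
      | last =>
        induction r using Fin.lastCases with
        | last => exact absurd hrs (lt_irrefl _)
        | cast r => rw [g1, g2]; exact Fin.castSucc_lt_last _
      | cast s =>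
        induction r using Fin.lastCases with
        | last => exact absurd hrs (not_lt.2 (Fin.le_last _))
        | cast r =>
          rw [g1, g1]
          exact Fin.castSucc_lt_castSucc_iff.2 (hf (Fin.castSucc_lt_castSucc_iff.1 hrs))
    obtain ⟨q, hq⟩ := exists_standard (fun i => glue x (g i))
      ((glue x).injective.comp hg.injective)
    refine hA q ?_ ⟨g, hg, hq⟩
    intro r s hrs hs
    have hs' : (s : ℕ) < j := by simpa using hs
    obtain ⟨s, rfl⟩ : ∃ t : Fin j, s = t.castSucc := ⟨⟨s, hs'⟩, rfl⟩
    obtain ⟨r, rfl⟩ : ∃ t : Fin j, r = t.castSucc := ⟨⟨r, hrs.trans hs'⟩, rfl⟩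
    rw [hq, g1, g1, glue_castSucc, glue_castSucc, Fin.succAbove_lt_succAbove_iff, ← hp]
    exact hrs
  · rintro hC q hq ⟨f, hf, hp⟩
    have hlt : ∀ i : Fin j, (f i.castSucc : ℕ) < m := fun i => by
      have h1 := hf (Fin.castSucc_lt_last i)
      have h2 := (f (Fin.last j)).isLt
      have h3 : (f i.castSucc : ℕ) < f (Fin.last j) := h1
      omega
    have hmono : StrictMono (fun i : Fin j => q i.castSucc) := fun r s hrs =>
      hq _ _ hrs (by simp)
    refine hC ⟨fun i => ⟨f i.castSucc, hlt i⟩, fun r s hrs => ?_, fun r s => ?_⟩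
    · exact hf (Fin.castSucc_lt_castSucc_iff.2 hrs)
    · have key := hp r.castSucc s.castSucc
      have e : ∀ i : Fin j, f i.castSucc = (⟨f i.castSucc, hlt i⟩ : Fin m).castSucc :=
        fun i => rfl
      rw [e r, e s, glue_castSucc, glue_castSucc, Fin.succAbove_lt_succAbove_iff] at key
      rw [← key]
      exact (hmono.lt_iff_lt (a := r) (b := s)).symm

/-- `av_n(A_k) = n · av_{n-1}(12⋯(k-1))`. -/
theorem stmt0 (k n : ℕ) (hk : 3 ≤ k) (hn : 1 ≤ n) :
    avSet n (Ak k) = n * avPat (n - 1) (Equiv.refl (Fin (k - 1))) := by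
  obtain ⟨m, rfl⟩ : ∃ m, n = m + 1 := ⟨n - 1, by omega⟩
  obtain ⟨j, rfl⟩ : ∃ j, k = j + 1 := ⟨k - 1, by omega⟩
  change avSet (m + 1) (Ak (j + 1)) = (m + 1) * avPat m (Equiv.refl (Fin j))
  unfold avSet avPat
  let e := Equiv.ofBijective _ (glue_bijective m)
  have e1 : {x : Fin (m + 1) × Equiv.Perm (Fin m) // ¬ Contains x.2 (Equiv.refl (Fin j))} ≃
      {p : Equiv.Perm (Fin (m + 1)) // AvoidsSet p (Ak (j + 1))} :=
    e.subtypeEquiv (fun x => (avoids_glue x).symm)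
  have e2 : {x : Fin (m + 1) × Equiv.Perm (Fin m) // ¬ Contains x.2 (Equiv.refl (Fin j))} ≃
      Fin (m + 1) × {p : Equiv.Perm (Fin m) // ¬ Contains p (Equiv.refl (Fin j))} :=
    { toFun := fun x => (x.1.1, ⟨x.1.2, x.2⟩)
      invFun := fun y => ⟨(y.1, y.2.1), y.2.2⟩
      left_inv := fun _ => rfl
      right_inv := fun _ => rfl }
  rw [← Nat.card_congr e1, Nat.card_congr e2, Nat.card_prod, Nat.card_fin]
end

section
/- Let k ≥ 3 and let p = p_1 p_2 ⋯ p_n be a permutation of length n ≥ 1. Then p avoids the set A_k if and only if the subsequence p_1 p_2 ⋯ p_{n-1} formed by its first n-1 entries avoids the increasing pattern 12⋯(k-1). -/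
/-- `p` contains the pattern `q` using only positions from the set `T`. -/
def ContainsOn {n k : ℕ} (p : Equiv.Perm (Fin n)) (q : Equiv.Perm (Fin k))
    (T : Set (Fin n)) : Prop :=
  ∃ f : Fin k → Fin n, StrictMono f ∧ (∀ r, f r ∈ T) ∧
    ∀ r s : Fin k, q r < q s ↔ p (f r) < p (f s)

/-- `p` avoids `A_k` iff the subsequence of its first `n-1` entries avoids `12⋯(k-1)`. -/
theorem stmt1 (k n : ℕ) (hk : 3 ≤ k) (hn : 1 ≤ n) (p : Equiv.Perm (Fin n)) :
    AvoidsSet p (Ak k) ↔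
      ¬ ContainsOn p (Equiv.refl (Fin (k - 1))) { j : Fin n | (j : ℕ) < n - 1 } := by
  constructor
  · rintro h ⟨f, hf, hT, hp⟩
    have hlast : n - 1 < n := by omega
    let g : Fin k → Fin n := fun r =>
      if hr : (r : ℕ) < k - 1 then f ⟨r, hr⟩ else ⟨n - 1, hlast⟩
    have hg : StrictMono g := by
      intro a b hab
      have hab' : (a : ℕ) < b := hab
      have hb := b.2
      have ha : (a : ℕ) < k - 1 := by omega
      by_cases hb' : (b : ℕ) < k - 1
      · simp only [g, ha, hb', dif_pos]
        exact hf hab'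
      · simp only [g, ha, hb', dif_pos]
        exact hT ⟨a, ha⟩
    let σ := Tuple.sort (p ∘ g)
    have hmono : StrictMono ((p ∘ g) ∘ σ) :=
      (Tuple.monotone_sort (p ∘ g)).strictMono_of_injective
        ((p.injective.comp hg.injective).comp σ.injective)
    have hq : ∀ r s : Fin k, σ.symm r < σ.symm s ↔ p (g r) < p (g s) := by
      intro r s
      have := hmono.lt_iff_lt (a := σ.symm r) (b := σ.symm s)
      simpa using this.symm
    refine h σ.symm ?_ ⟨g, hg, hq⟩
    intro r s hrs hs
    rw [hq]
    have hr : (r : ℕ) < k - 1 := by omega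
    simp only [g, hr, hs, dif_pos]
    exact (hp ⟨r, hr⟩ ⟨s, hs⟩).1 hrs
  · rintro h q hq ⟨f, hf, hp⟩
    have hle : k - 1 ≤ k := by omega
    have hmono : StrictMono (fun r : Fin (k - 1) => p (f (Fin.castLE hle r))) := by
      intro a b hab
      exact (hp _ _).1 (hq _ _ hab b.2)
    refine h ⟨fun r => f (Fin.castLE hle r), ?_, ?_, ?_⟩
    · intro a b hab
      exact hf hab
    · intro r
      have hr := r.2
      have h1 : f (Fin.castLE hle r) < f ⟨k - 1, by omega⟩ := hf hr
      have h2 := (f ⟨k - 1, by omega⟩).2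
      have h3 : (f (Fin.castLE hle r) : ℕ) < f ⟨k - 1, by omega⟩ := h1
      show (f (Fin.castLE hle r) : ℕ) < n - 1
      omega
    · intro r s
      exact hmono.lt_iff_lt.symm
end

section
/- For all integers k ≥ 3 and all i with 2 ≤ i ≤ k-1, the sequence (av_n(A_{k,i}))^{1/n} converges, as n → ∞, to (k-2)^2. -/
/-- zero-indexed rank -/
def rk {n : ℕ} (p : Equiv.Perm (Fin n)) (x : Fin n) : ℕ :=
  Finset.univ.sup (fun y : {y : Fin n // y < x ∧ p y < p x} => rk p y.1 + 1)
termination_by x.val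
decreasing_by exact y.2.1

lemma rk_lt {n : ℕ} (p : Equiv.Perm (Fin n)) {x y : Fin n} (h : y < x) (h' : p y < p x) :
    rk p y < rk p x := by
  rw [rk.eq_1 p x]
  exact Finset.le_sup (f := fun y : {y : Fin n // y < x ∧ p y < p x} => rk p y.1 + 1)
    (Finset.mem_univ ⟨y, h, h'⟩)

lemma rk_le {n : ℕ} (p : Equiv.Perm (Fin n)) {x : Fin n} {c : ℕ}
    (h : ∀ y, y < x → p y < p x → rk p y < c) : rk p x ≤ c := by
  rw [rk.eq_1 p x]
  exact Finset.sup_le fun y _ => h y.1 y.2.1 y.2.2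

lemma rk_pred {n : ℕ} (p : Equiv.Perm (Fin n)) {x : Fin n} {r : ℕ} (h : rk p x = r + 1) :
    ∃ y, y < x ∧ p y < p x ∧ rk p y = r := by
  by_contra! hc
  have : rk p x ≤ r := by
    apply rk_le
    intro y h1 h2
    have h3 := rk_lt p h1 h2
    have h4 := hc y h1 h2
    omega
  omega

lemma rk_anti {n : ℕ} (p : Equiv.Perm (Fin n)) {x y : Fin n} (h : y < x)
    (hr : rk p y = rk p x) : p x < p y := by
  by_contra hc
  have h1 : p y ≠ p x := fun e => h.ne (p.injective e)
  have := rk_lt p h (lt_of_le_of_ne (not_lt.mp hc) h1)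
  omega

lemma exists_chain {n : ℕ} (p : Equiv.Perm (Fin n)) (r : ℕ) : ∀ x, rk p x = r →
    ∃ f : ℕ → Fin n, f r = x ∧ (∀ t ≤ r, rk p (f t) = t) ∧
      ∀ t < r, f t < f (t + 1) ∧ p (f t) < p (f (t + 1)) := by
  induction r with
  | zero =>
    intro x hx
    exact ⟨fun _ => x, rfl, fun t ht => by simp only [Nat.le_zero] at ht; rw [hx, ht], by simp⟩
  | succ r ih =>
    intro x hx
    obtain ⟨y, h1, h2, h3⟩ := rk_pred p hx
    obtain ⟨f, f1, f2, f3⟩ := ih y h3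
    refine ⟨fun t => if t ≤ r then f t else x, by simp, ?_, ?_⟩
    · intro t ht
      by_cases h : t ≤ r
      · simp [h, f2]
      · simp only [h, if_false]; omega
    · intro t ht
      by_cases h : t + 1 ≤ r
      · simp only [h, if_true, show t ≤ r by omega]; exact f3 t (by omega)
      · have : t = r := by omega
        subst this
        simp [f1, h1, h2]

lemma rk_determines {n : ℕ} {p q : Equiv.Perm (Fin n)} (h1 : rk p = rk q)
    (h2 : rk p ∘ p.symm = rk q ∘ q.symm) : p = q := by
  have key : ∀ c : ℕ, (fun x : {x : Fin n // rk p x = c} => OrderDual.toDual (p x.1)) =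
      (fun x : {x : Fin n // rk p x = c} => OrderDual.toDual (q x.1)) := by
    intro c
    refine (StrictMono.range_inj ?_ ?_).mp ?_
    · intro a b hab
      exact rk_anti p hab (a.2.trans b.2.symm)
    · intro a b hab
      refine rk_anti q hab ?_
      rw [← h1]; exact a.2.trans b.2.symm
    · ext y
      constructor
      · rintro ⟨⟨x, hx⟩, rfl⟩
        refine ⟨⟨q.symm (p x), ?_⟩, by simp⟩
        have := congrFun h2 (p x)
        simp only [Function.comp_apply, Equiv.symm_apply_apply] at this
        rw [h1, ← this, hx]
      · rintro ⟨⟨x, hx⟩, rfl⟩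
        refine ⟨⟨p.symm (q x), ?_⟩, by simp⟩
        have := congrFun h2 (q x)
        simp only [Function.comp_apply, Equiv.symm_apply_apply] at this
        rw [this, ← h1, hx]
  ext x
  have := congrFun (key (rk p x)) ⟨x, rfl⟩
  simp only [OrderDual.toDual_inj] at this
  rw [this]

lemma chain_mono {n : ℕ} {f : ℕ → Fin n} {r : ℕ} (h : ∀ t < r, f t < f (t + 1)) :
    ∀ b ≤ r, ∀ a < b, f a < f b := by
  intro b
  induction b with
  | zero => intro _ a ha; omega
  | succ b ih =>
    intro hb a ha
    rcases Nat.lt_succ_iff_lt_or_eq.mp ha with h1 | rfl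
    · exact (ih (by omega) a h1).trans (h b (by omega))
    · exact h a (by omega)

lemma exists_std {k n : ℕ} (h : Fin k → Fin n) (hinj : Function.Injective h) :
    ∃ q : Equiv.Perm (Fin k), ∀ r s, q r < q s ↔ h r < h s := by
  have hs : StrictMono (h ∘ Tuple.sort h) :=
    (Tuple.monotone_sort h).strictMono_of_injective (hinj.comp (Tuple.sort h).injective)
  refine ⟨(Tuple.sort h).symm, fun r s => ?_⟩
  rw [← hs.lt_iff_lt]
  simp

lemma avoid_key {n k i : ℕ} (hi1 : 2 ≤ i) (hi2 : i ≤ k - 1)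
    {p : Equiv.Perm (Fin n)} (hp : AvoidsSet p (Aki k i)) (f : ℕ → Fin n)
    (hf : ∀ t < k - 2, f t < f (t + 1) ∧ p (f t) < p (f (t + 1))) (x : Fin n)
    (hx : f (k - 2) < x) : p (f (i - 2)) < p x ∧ p x < p (f (i - 1)) := by
  have m1 := chain_mono (r := k - 2) (fun t ht => (hf t ht).1)
  have m2 := chain_mono (f := fun t => p (f t)) (r := k - 2) (fun t ht => (hf t ht).2)
  let F : Fin k → Fin n := fun r => if (r : ℕ) ≤ k - 2 then f r else x
  have hF : StrictMono F := by
    intro a b hab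
    have hab' : (a : ℕ) < b := hab
    simp only [F]
    by_cases hb : (b : ℕ) ≤ k - 2
    · simp only [hb, show (a : ℕ) ≤ k - 2 by omega, if_true]
      exact m1 _ hb _ hab'
    · have ha : (a : ℕ) ≤ k - 2 := by omega
      simp only [hb, ha, if_true, if_false]
      rcases eq_or_lt_of_le ha with h | h
      · rw [h]; exact hx
      · exact (m1 _ le_rfl _ h).trans hx
  obtain ⟨q, hq⟩ := exists_std (fun r => p (F r)) (p.injective.comp hF.injective)
  have hmem : q ∈ Ak k := by
    intro r s hrs hs
    rw [hq]
    simp only [F, show (r : ℕ) ≤ k - 2 by omega, show (s : ℕ) ≤ k - 2 by omega, if_true]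
    exact m2 _ (by omega) _ hrs
  let L : Fin k := ⟨k - 1, by omega⟩
  have hL : (q L : ℕ) = i - 1 := by
    by_contra hne
    refine hp q ⟨hmem, ?_⟩ ⟨F, hF, hq⟩
    intro j hj
    have : j = L := Fin.ext hj
    rwa [this]
  have lo : ∀ t (ht : t < k - 1), t ≤ (q ⟨t, by omega⟩ : ℕ) := by
    intro t
    induction t with
    | zero => intro _; omega
    | succ t ih =>
      intro ht
      have h1 := ih (by omega)
      have h2 : q ⟨t, by omega⟩ < q ⟨t + 1, by omega⟩ := hmem _ _ (by simp) ht
      have h3 : (q ⟨t, by omega⟩ : ℕ) < q ⟨t + 1, by omega⟩ := h2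
      omega
  have hi : ∀ u t (ht : t + u = k - 2), (q ⟨t, by omega⟩ : ℕ) ≤ t + 1 := by
    intro u
    induction u with
    | zero => intro t ht; have := (q ⟨t, by omega⟩).2; omega
    | succ u ih =>
      intro t ht
      have h1 := ih (t + 1) (by omega)
      have h2 : q ⟨t, by omega⟩ < q ⟨t + 1, by omega⟩ := hmem _ _ (by simp) (by simp; omega)
      have h3 : (q ⟨t, by omega⟩ : ℕ) < q ⟨t + 1, by omega⟩ := h2
      omega
  have hne : ∀ t (ht : t < k - 1), (q ⟨t, by omega⟩ : ℕ) ≠ i - 1 := by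
    intro t ht h
    have : q ⟨t, by omega⟩ = q L := Fin.ext (by rw [h, hL])
    have := congrArg Fin.val (q.injective this)
    simp [L] at this
    omega
  have hLx : F L = x := by simp only [F, L]; rw [if_neg (by omega)]
  constructor
  · have h1 := hi (k - i) (i - 2) (by omega)
    have h2 := hne (i - 2) (by omega)
    have h3 : q ⟨i - 2, by omega⟩ < q L := Fin.lt_def.mpr (by omega)
    have h4 := (hq _ _).mp h3
    rw [hLx] at h4
    simpa [F, show i - 2 ≤ k - 2 by omega] using h4
  · have h1 := lo (i - 1) (by omega)
    have h2 := hne (i - 1) (by omega)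
    have h3 : q L < q ⟨i - 1, by omega⟩ := Fin.lt_def.mpr (by omega)
    have h4 := (hq _ _).mp h3
    rw [hLx] at h4
    simp only [F, show i - 1 ≤ k - 2 by omega, if_true] at h4
    exact h4

/-- decode the position ranks -/
def decPos (n m d : ℕ) (cp : Fin n → Fin m) (J : Fin (n + 1)) : Fin n → ℕ :=
  fun x => if x.val = J.val ∨ (J.val < x.val ∧ (cp x).val = d) then m else (cp x).val

/-- decode the value ranks -/
def decVal (n m d : ℕ) (cv : Fin n → Fin m) (V A B : Fin (n + 1)) : Fin n → ℕ :=
  fun y => if y.val = V.val ∨ (A.val ≤ y.val ∧ y.val ≤ B.val ∧ (cv y).val = d) then m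
    else (cv y).val

lemma decode_exists {n m d : ℕ} (hd : d < m) (p : Equiv.Perm (Fin n))
    (hle : ∀ x, rk p x ≤ m) (J V A B : Fin (n + 1))
    (h1 : ∀ x : Fin n, x.val = J.val → rk p x = m)
    (h2 : ∀ x : Fin n, x.val < J.val → rk p x < m)
    (h3 : ∀ x : Fin n, J.val < x.val → rk p x ≠ d)
    (h4 : ∀ x : Fin n, (p x).val = V.val ↔ x.val = J.val)
    (h5 : ∀ x : Fin n, J.val < x.val → rk p x = m → A.val ≤ (p x).val ∧ (p x).val ≤ B.val)
    (h6 : ∀ x : Fin n, rk p x = d → ¬ (A.val ≤ (p x).val ∧ (p x).val ≤ B.val)) :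
    ∃ cp cv, decPos n m d cp J = rk p ∧ decVal n m d cv V A B = rk p ∘ p.symm := by
  let c : Fin n → Fin m := fun x => if h : rk p x < m then ⟨rk p x, h⟩ else ⟨d, hd⟩
  have c1 : ∀ x, rk p x < m → (c x).val = rk p x := by
    intro x hx; simp [c, hx]
  have c2 : ∀ x, rk p x = m → (c x).val = d := by
    intro x hx; simp [c, hx]
  refine ⟨c, c ∘ p.symm, ?_, ?_⟩
  · ext x
    unfold decPos
    have g1 := h1 x; have g2 := h2 x; have g3 := h3 x; have g4 := c1 x; have g5 := c2 x
    have g6 := hle x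
    split_ifs with h
    · omega
    · omega
  · ext y
    obtain ⟨x, rfl⟩ := p.surjective y
    unfold decVal
    simp only [Function.comp_apply, Equiv.symm_apply_apply]
    have g1 := h1 x; have g2 := h2 x; have g3 := h3 x; have g4 := c1 x; have g5 := c2 x
    have g6 := hle x; have g7 := h4 x; have g8 := h5 x; have g9 := h6 x
    split_ifs with h
    · omega
    · omega

lemma avoid_decode {n k i : ℕ} (hi1 : 2 ≤ i) (hi2 : i ≤ k - 1)
    {p : Equiv.Perm (Fin n)} (hp : AvoidsSet p (Aki k i)) :
    ∃ cp cv J V A B, decPos n (k - 2) (i - 2) cp J = rk p ∧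
      decVal n (k - 2) (i - 2) cv V A B = rk p ∘ p.symm := by
  have hle : ∀ x, rk p x ≤ k - 2 := by
    intro x
    refine rk_le p ?_
    intro y h1 h2
    by_contra hc
    -- find an entry of rank exactly k-2 weakly below y
    obtain ⟨f, f1, f2, f3⟩ := exists_chain p (rk p y) y rfl
    have hfx : f (k - 2) < x := by
      rcases eq_or_lt_of_le (not_lt.mp hc) with h | h
      · rw [h, f1]; exact h1
      · exact (chain_mono (fun t ht => (f3 t ht).1) _ le_rfl _ h |>.trans_le (by rw [f1])).trans h1
    have h3 := (avoid_key hi1 hi2 hp f (fun t ht => f3 t (by omega)) x hfx).2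
    have h4 : p (f (i - 1)) ≤ p y := by
      rcases eq_or_lt_of_le (show i - 1 ≤ rk p y by omega) with h | h
      · rw [h, f1]
      · have := chain_mono (f := fun t => p (f t)) (fun t ht => (f3 t ht).2) _ le_rfl _ h
        simp only [f1] at this
        exact this.le
    exact absurd (h3.trans_le h4) (not_lt.mpr h2.le)
  by_cases hex : ∃ x, rk p x = k - 2
  swap
  · push Not at hex
    obtain ⟨cp, cv, h⟩ := decode_exists (m := k - 2) (d := i - 2) (by omega) p hle
      (Fin.last n) (Fin.last n) (Fin.last n) (Fin.last n)
      (fun x hx => by have := x.2; simp at hx; omega)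
      (fun x hx => lt_of_le_of_ne (hle x) (hex x))
      (fun x hx => by have := x.2; simp at hx; omega)
      (fun x => by have := x.2; have := (p x).2; simp; omega)
      (fun x hx => by have := x.2; simp at hx; omega)
      (fun x hx => by have := x.2; have := (p x).2; simp)
    exact ⟨cp, cv, _, _, _, _, h⟩
  · obtain ⟨j, hj, hmin⟩ := Finset.exists_min_image
      (Finset.univ.filter (fun x => rk p x = k - 2)) id (by
        obtain ⟨x, hx⟩ := hex; exact ⟨x, by simp [hx]⟩)
    simp only [Finset.mem_filter, Finset.mem_univ, true_and, id] at hj hmin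
    obtain ⟨f, f1, f2, f3⟩ := exists_chain p (k - 2) j hj
    have hk : ∀ x, j < x → p (f (i - 2)) < p x ∧ p x < p (f (i - 1)) := by
      intro x hx
      exact avoid_key hi1 hi2 hp f f3 x (by rw [f1]; exact hx)
    have h3 : ∀ x, j < x → rk p x ≠ i - 2 := by
      intro x hx
      have hpos : f (i - 2) < x :=
        (chain_mono (fun t ht => (f3 t ht).1) _ le_rfl (i - 2) (by omega)).trans (by rwa [f1])
      have := rk_lt p hpos (hk x hx).1
      rw [f2 _ (by omega)] at this
      omega
    have h6 : ∀ x y z, j < y → j < z → rk p x = i - 2 → ¬ (p y ≤ p x ∧ p x ≤ p z) := by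
      rintro x y z hy hz hx ⟨hyx, hxz⟩
      have l1 := (hk y hy).1.trans_le hyx
      have l2 := hxz.trans_lt (hk z hz).2
      have hrf := f2 (i - 2) (by omega)
      have hxl : x < f (i - 2) := by
        rcases lt_trichotomy x (f (i - 2)) with h | h | h
        · exact h
        · rw [h] at l1; exact absurd l1 (lt_irrefl _)
        · have := rk_lt p h l1; omega
      have hff := (f3 (i - 2) (by omega)).1
      obtain ⟨g, g1, g2, g3⟩ := exists_chain p (i - 2) x hx
      have hi : i - 2 + 1 = i - 1 := by omega
      rw [hi] at hff
      have := (avoid_key hi1 hi2 hp (fun t => if t ≤ i - 2 then g t else f t) (by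
        intro t ht
        by_cases h : t + 1 ≤ i - 2
        · simp only [h, if_true, show t ≤ i - 2 by omega]; exact g3 t (by omega)
        · by_cases h' : t ≤ i - 2
          · have : t = i - 2 := by omega
            subst this
            simp only [le_refl, if_true, if_neg h, g1]
            rw [hi]
            exact ⟨hxl.trans hff, l2⟩
          · simp only [h, h', if_false]; exact f3 t ht) y (by
        simp only [if_neg (show ¬ k - 2 ≤ i - 2 by omega), f1]; exact hy)).1
      simp only [le_refl, if_true, g1] at this
      exact absurd this (not_lt.mpr hyx)
    have fin : ∀ A B : Fin (n + 1),
        (∀ x : Fin n, j < x → rk p x = k - 2 → A.val ≤ (p x).val ∧ (p x).val ≤ B.val) →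
        (∀ x : Fin n, rk p x = i - 2 → ¬ (A.val ≤ (p x).val ∧ (p x).val ≤ B.val)) →
        ∃ cp cv J V A B, decPos n (k - 2) (i - 2) cp J = rk p ∧
          decVal n (k - 2) (i - 2) cv V A B = rk p ∘ p.symm := by
      intro A B h5 h6
      obtain ⟨cp, cv, h⟩ := decode_exists (m := k - 2) (d := i - 2) (by omega) p hle
        j.castSucc (p j).castSucc A B
        (fun x hx => by
          have : x = j := Fin.ext (by simpa using hx)
          rw [this, hj])
        (fun x hx => by
          refine lt_of_le_of_ne (hle x) fun h => ?_
          exact absurd (hmin x h) (not_le.mpr (by simpa using hx)))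
        (fun x hx => h3 x (by simpa using hx))
        (fun x => by
          simp only [Fin.val_castSucc, Fin.val_inj]
          exact p.injective.eq_iff)
        (fun x hx => h5 x (by simpa using hx)) h6
      exact ⟨cp, cv, _, _, _, _, h⟩
    by_cases hR : (Finset.univ.filter (fun x => j < x ∧ rk p x = k - 2)).Nonempty
    · obtain ⟨a, ha, hamin⟩ := Finset.exists_min_image _ (fun x => p x) hR
      obtain ⟨b, hb, hbmax⟩ := Finset.exists_max_image _ (fun x => p x) hR
      simp only [Finset.mem_filter, Finset.mem_univ, true_and] at ha hb hamin hbmax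
      refine fin (p a).castSucc (p b).castSucc ?_ ?_
      · intro x hx hr
        exact ⟨hamin x ⟨hx, hr⟩, hbmax x ⟨hx, hr⟩⟩
      · intro x hx h
        exact h6 x a b ha.1 hb.1 hx h
    · refine fin (Fin.last n) (Fin.last n) ?_ ?_
      · intro x hx hr
        exact absurd ⟨x, by simp [hx, hr]⟩ hR
      · intro x _ h
        have := (p x).2
        simp at h
        omega

lemma av_upper {n k i : ℕ} (hi1 : 2 ≤ i) (hi2 : i ≤ k - 1) :
    avSet n (Aki k i) ≤ (n + 1) ^ 4 * ((k - 2) ^ 2) ^ n := by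
  classical
  let X := (Fin n → Fin (k - 2)) × (Fin n → Fin (k - 2)) × Fin (n + 1) × Fin (n + 1) ×
    Fin (n + 1) × Fin (n + 1)
  have hch : ∀ p : {p : Equiv.Perm (Fin n) // AvoidsSet p (Aki k i)}, ∃ x : X,
      decPos n (k - 2) (i - 2) x.1 x.2.2.1 = rk p.1 ∧
      decVal n (k - 2) (i - 2) x.2.1 x.2.2.2.1 x.2.2.2.2.1 x.2.2.2.2.2 = rk p.1 ∘ p.1.symm := by
    intro p
    obtain ⟨cp, cv, J, V, A, B, h⟩ := avoid_decode hi1 hi2 p.2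
    exact ⟨(cp, cv, J, V, A, B), h⟩
  choose F hF using hch
  have hinj : Function.Injective F := by
    intro p q hpq
    have h1 := hF p
    have h2 := hF q
    rw [hpq] at h1
    exact Subtype.ext (rk_determines (h1.1.symm.trans h2.1) (h1.2.symm.trans h2.2))
  have := Nat.card_le_card_of_injective F hinj
  refine this.trans (le_of_eq ?_)
  simp only [X, Nat.card_eq_fintype_card, Fintype.card_prod, Fintype.card_fin,
    Fintype.card_fun]
  rw [← pow_mul]
  ring

/-- `p` has an `m`-colouring that increases along ascents -/
def Colo {n : ℕ} (m : ℕ) (p : Equiv.Perm (Fin n)) : Prop :=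
  ∃ c : Fin n → Fin m, ∀ y x, y < x → p y < p x → c y < c x

lemma Colo.avoids {n k i : ℕ} (hk : 3 ≤ k) {p : Equiv.Perm (Fin n)} (h : Colo (k - 2) p) :
    AvoidsSet p (Aki k i) := by
  obtain ⟨c, hc⟩ := h
  rintro q ⟨hq, -⟩ ⟨f, hf, hqf⟩
  let e : Fin (k - 1) → Fin k := Fin.castLE (by omega)
  have hm : StrictMono (fun r : Fin (k - 1) => c (f (e r))) := by
    intro r s hrs
    have hrs' : e r < e s := hrs
    refine hc _ _ (hf hrs') ?_
    rw [← hqf]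
    exact hq _ _ hrs' s.2
  have := Fintype.card_le_of_injective _ hm.injective
  simp at this
  omega

/-- number of colourable permutations -/
noncomputable def colN (m n : ℕ) : ℕ := Nat.card {p : Equiv.Perm (Fin n) // Colo m p}

lemma colN_le_avSet {n k i : ℕ} (hk : 3 ≤ k) : colN (k - 2) n ≤ avSet n (Aki k i) :=
  Nat.card_le_card_of_injective
    (fun p : {p : Equiv.Perm (Fin n) // Colo (k - 2) p} =>
      (⟨p.1, p.2.avoids hk⟩ : {p : Equiv.Perm (Fin n) // AvoidsSet p (Aki k i)}))
    (fun p q h => Subtype.ext (by simpa using h))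

/-- prepend a new maximum -/
def extP {n : ℕ} (p : Equiv.Perm (Fin n)) : Equiv.Perm (Fin (n + 1)) :=
  (finSuccEquiv n).trans ((Equiv.optionCongr p).trans (finSuccEquivLast).symm)

lemma extP_zero {n : ℕ} (p : Equiv.Perm (Fin n)) : extP p 0 = Fin.last n := by
  simp [extP]

lemma extP_succ {n : ℕ} (p : Equiv.Perm (Fin n)) (x : Fin n) :
    extP p x.succ = (p x).castSucc := by
  simp [extP]

lemma colN_mono_succ {m : ℕ} (hm : 1 ≤ m) (n : ℕ) : colN m n ≤ colN m (n + 1) := by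
  refine Nat.card_le_card_of_injective
    (fun p : {p : Equiv.Perm (Fin n) // Colo m p} =>
      (⟨extP p.1, ?_⟩ : {p : Equiv.Perm (Fin (n + 1)) // Colo m p})) ?_
  · obtain ⟨p, c, hc⟩ := p
    refine ⟨Fin.cases ⟨0, hm⟩ c, ?_⟩
    intro y x hyx hp
    induction y using Fin.cases with
    | zero =>
      simp only [extP_zero] at hp
      exact absurd hp (not_lt.mpr (Fin.le_last _))
    | succ y =>
      induction x using Fin.cases with
      | zero => exact absurd hyx (by simp)
      | succ x =>
        simp only [extP_succ] at hp
        simpa using hc y x (by simpa using hyx) (by simpa using hp)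
  · intro p q h
    simp only [Subtype.mk.injEq] at h
    refine Subtype.ext (Equiv.ext fun x => ?_)
    have := congrArg (fun e => e x.succ) h
    simpa [extP_succ] using this

lemma colN_mono {m : ℕ} (hm : 1 ≤ m) : Monotone (colN m) :=
  monotone_nat_of_le_succ (colN_mono_succ hm)

/-- rectangular standard Young tableaux -/
def SYT (m n : ℕ) (J : Type) [LinearOrder J] : Set ((Fin m × J) ≃ Fin n) :=
  {P | (∀ c, StrictMono fun j => P (c, j)) ∧ ∀ j, StrictMono fun c => P (c, j)}

/-- the permutation of a pair of tableaux -/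
def pairP {m n : ℕ} {J : Type} (P V : (Fin m × J) ≃ Fin n) : Equiv.Perm (Fin n) :=
  P.symm.trans (((Equiv.prodCongr Fin.revPerm (Equiv.refl J)).trans V).trans Fin.revPerm)

lemma pairP_apply {m n : ℕ} {J : Type} (P V : (Fin m × J) ≃ Fin n) (c : Fin m) (j : J) :
    pairP P V (P (c, j)) = Fin.rev (V (Fin.rev c, j)) := by
  simp [pairP]

lemma pairP_color {m n : ℕ} {J : Type} [LinearOrder J] {P V : (Fin m × J) ≃ Fin n}
    (hP : P ∈ SYT m n J) (hV : V ∈ SYT m n J) {c c' : Fin m} {j j' : J}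
    (h1 : P (c, j) < P (c', j'))
    (h2 : pairP P V (P (c, j)) < pairP P V (P (c', j'))) : c < c' := by
  by_contra hc
  rw [not_lt] at hc
  rw [pairP_apply, pairP_apply, Fin.rev_lt_rev] at h2
  have a1 : P (c', j) < P (c', j') := ((hP.2 j).monotone hc).trans_lt h1
  have a2 : V (Fin.rev c', j') < V (Fin.rev c', j) :=
    h2.trans_le ((hV.2 j).monotone (Fin.rev_le_rev.mpr hc))
  have b1 := (hP.1 c').lt_iff_lt.mp a1
  have b2 := (hV.1 _).lt_iff_lt.mp a2
  exact absurd b1 (not_lt.mpr b2.le)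

lemma pairP_rk {m n : ℕ} {J : Type} [LinearOrder J] {P V : (Fin m × J) ≃ Fin n}
    (hP : P ∈ SYT m n J) (hV : V ∈ SYT m n J) (x : Fin n) :
    rk (pairP P V) x = ((P.symm x).1 : ℕ) := by
  apply le_antisymm
  · induction x using WellFoundedLT.induction with
    | ind x ih =>
      refine rk_le _ fun y h1 h2 => ?_
      refine (ih y h1).trans_lt ?_
      have : (P.symm y).1 < (P.symm x).1 := by
        refine pairP_color hP hV (j := (P.symm y).2) (j' := (P.symm x).2) ?_ ?_
        · simpa using h1
        · simpa using h2
      exact this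
  · have key : ∀ (t : ℕ) (ht : t < m) (j : J), t ≤ rk (pairP P V) (P (⟨t, ht⟩, j)) := by
      intro t
      induction t with
      | zero => intro _ _; omega
      | succ t ih =>
        intro ht j
        have h0 : (⟨t, by omega⟩ : Fin m) < ⟨t + 1, ht⟩ := by simp [Fin.lt_def]
        have := rk_lt (pairP P V) (hP.2 j h0) (by
          simp only [pairP_apply, Fin.rev_lt_rev]
          exact hV.2 j (Fin.rev_lt_rev.mpr h0))
        have := ih (by omega) j
        simp only at *
        omega
    have := key (P.symm x).1 (P.symm x).1.2 (P.symm x).2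
    simpa using this

lemma SYT_sq_le (m n : ℕ) (J : Type) [LinearOrder J] [Finite J] :
    Nat.card (SYT m n J) ^ 2 ≤ colN m n := by
  rw [sq, ← Nat.card_prod]
  refine Nat.card_le_card_of_injective
    (fun PV : SYT m n J × SYT m n J => (⟨pairP PV.1.1 PV.2.1, ?_⟩ :
      {p : Equiv.Perm (Fin n) // Colo m p})) ?_
  · obtain ⟨⟨P, hP⟩, ⟨V, hV⟩⟩ := PV
    refine ⟨fun x => (P.symm x).1, fun y x h1 h2 => ?_⟩
    have := rk_lt _ h1 h2
    rw [pairP_rk hP hV, pairP_rk hP hV] at this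
    exact this
  · rintro ⟨⟨P, hP⟩, ⟨V, hV⟩⟩ ⟨⟨P', hP'⟩, ⟨V', hV'⟩⟩ h
    simp only [Subtype.mk.injEq] at h
    have hcol : ∀ x, (P.symm x).1 = (P'.symm x).1 := by
      intro x
      apply Fin.ext
      rw [← pairP_rk hP hV, ← pairP_rk hP' hV', h]
    have hPP : P = P' := by
      have key : ∀ c, (fun j => P (c, j)) = fun j => P' (c, j) := by
        intro c
        have hr : ∀ Q : (Fin m × J) ≃ Fin n,
            Set.range (fun j => Q (c, j)) = {x | (Q.symm x).1 = c} := by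
          intro Q
          ext x
          constructor
          · rintro ⟨j, rfl⟩; simp
          · intro hx
            refine ⟨(Q.symm x).2, ?_⟩
            have : (c, (Q.symm x).2) = Q.symm x := Prod.ext hx.symm rfl
            simp [this]
        refine (StrictMono.range_inj (hP.1 c) (hP'.1 c)).mp ?_
        rw [hr, hr]
        ext x
        simp [hcol]
      ext ⟨c, j⟩
      exact congrArg Fin.val (congrFun (key c) j)
    subst hPP
    have hVV : V = V' := by
      ext ⟨c, j⟩
      have := congrArg (fun e => e (P (Fin.rev c, j))) h
      simp only [pairP_apply, Fin.rev_rev, Fin.rev_inj] at this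
      rw [this]
    subst hVV
    rfl

/-- rowwise increasing fillings -/
def RowM (m l : ℕ) : Set ((Fin m × Fin l) ≃ Fin (m * l)) :=
  {s | ∀ c, StrictMono fun j => s (c, j)}

lemma RowM_card (m l : ℕ) :
    (m * l).factorial ≤ Nat.card (RowM m l) * l.factorial ^ m := by
  classical
  have h : Function.Surjective
      (fun x : RowM m l × (Fin m → Equiv.Perm (Fin l)) =>
        (Equiv.prodShear (Equiv.refl (Fin m)) x.2).trans x.1.1) := by
    intro e
    let τ : Fin m → Equiv.Perm (Fin l) := fun c => Tuple.sort (fun j => e (c, j))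
    refine ⟨(⟨(Equiv.prodShear (Equiv.refl (Fin m)) τ).trans e, ?_⟩, fun c => (τ c).symm), ?_⟩
    · intro c
      have h1 := Tuple.monotone_sort (fun j => e (c, j))
      refine (h1.strictMono_of_injective ?_)
      intro a b hab
      simpa using hab
    · ext ⟨c, j⟩
      simp [Equiv.prodShear]
  have := Nat.card_le_card_of_surjective _ h
  rw [Nat.card_prod, Nat.card_eq_fintype_card (α := (Fin m × Fin l) ≃ Fin (m * l)),
    Fintype.card_equiv finProdFinEquiv,
    Nat.card_eq_fintype_card (α := Fin m → Equiv.Perm (Fin l))] at this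
  simpa [Fintype.card_perm] using this

lemma fact_bound (m : ℕ) : ∀ l : ℕ,
    ((l + 1).factorial) ^ m * m ^ (m * (l + 1)) ≤ (m * (l + 1)).factorial * (m * (l + 1)) ^ m := by
  intro l
  induction l with
  | zero =>
    simp only [zero_add, Nat.factorial_one, one_pow, one_mul, mul_one]
    exact Nat.le_mul_of_pos_left _ (Nat.factorial_pos m)
  | succ l ih =>
    have h1 : (m * (l + 1)).factorial * (m * (l + 1)) ^ m ≤ (m * (l + 1 + 1)).factorial := by
      rw [show m * (l + 1 + 1) = m * (l + 1) + m by ring]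
      refine le_trans (Nat.mul_le_mul_left _ (Nat.pow_le_pow_left (Nat.le_succ _) m)) ?_
      exact Nat.factorial_mul_pow_le_factorial
    calc ((l + 1 + 1).factorial) ^ m * m ^ (m * (l + 1 + 1))
        = (((l + 1).factorial) ^ m * m ^ (m * (l + 1))) * (m * (l + 1 + 1)) ^ m := by
          rw [Nat.factorial_succ (l + 1), mul_pow, mul_pow, Nat.mul_succ m (l + 1), pow_add]
          ring
      _ ≤ (m * (l + 1 + 1)).factorial * (m * (l + 1 + 1)) ^ m :=
          Nat.mul_le_mul_right _ (ih.trans h1)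

lemma RowM_lower (m l : ℕ) (hl : 1 ≤ l) :
    m ^ (m * l) ≤ Nat.card (RowM m l) * (m * l) ^ m := by
  obtain ⟨l, rfl⟩ : ∃ l', l = l' + 1 := ⟨l - 1, by omega⟩
  have h1 := fact_bound m l
  have h2 := RowM_card m (l + 1)
  have h3 : 0 < (l + 1).factorial ^ m := pow_pos (Nat.factorial_pos _) _
  refine Nat.le_of_mul_le_mul_left ?_ h3
  refine h1.trans ((Nat.mul_le_mul_right _ h2).trans (le_of_eq ?_))
  ring

lemma exists_rank_equiv {E : Type} [Fintype E] {n : ℕ} (h : Fintype.card E = n) (K : E → ℕ)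
    (hK : Function.Injective K) : ∃ P : E ≃ Fin n, ∀ a b, P a < P b ↔ K a < K b := by
  let _ : LinearOrder E := LinearOrder.lift' K hK
  refine ⟨(Fintype.orderIsoFinOfCardEq E h).symm.toEquiv, fun a b => ?_⟩
  exact (Fintype.orderIsoFinOfCardEq E h).symm.lt_iff_lt

lemma equiv_ext_of_order {E : Type} {n : ℕ} {s t : E ≃ Fin n}
    (h : ∀ a b, s a < s b ↔ t a < t b) : s = t := by
  have hm : StrictMono (fun x => t (s.symm x)) := by
    intro x y hxy
    rw [← h]
    simpa using hxy
  have := (StrictMono.range_inj hm strictMono_id).mp (by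
    rw [Set.range_id]
    exact (s.symm.trans t).surjective.range_eq)
  ext a
  have := congrFun this (s a)
  simp at this
  rw [this]

/-- key function of a family of blocks -/
def keyF (m t l : ℕ) (σ : ℕ → RowM m l) (e : Fin m × (Fin (t + m) ×ₗ Fin l)) : ℕ :=
  ((σ ((ofLex e.2).1.val + e.1.val)).1 (e.1, (ofLex e.2).2)).val +
    (m * l) * ((ofLex e.2).1.val + e.1.val)

lemma keyF_lt_of_block {m t l : ℕ} (σ : ℕ → RowM m l) {e e' : Fin m × (Fin (t + m) ×ₗ Fin l)}
    (h : (ofLex e.2).1.val + e.1.val < (ofLex e'.2).1.val + e'.1.val) :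
    keyF m t l σ e < keyF m t l σ e' := by
  unfold keyF
  have h1 := ((σ ((ofLex e.2).1.val + e.1.val)).1 (e.1, (ofLex e.2).2)).2
  have h2 := Nat.mul_le_mul_left (m * l) h
  rw [Nat.mul_succ] at h2
  omega

lemma keyF_inj {m t l : ℕ} (σ : ℕ → RowM m l) : Function.Injective (keyF m t l σ) := by
  intro e e' h
  rcases lt_trichotomy ((ofLex e.2).1.val + e.1.val) ((ofLex e'.2).1.val + e'.1.val)
    with h1 | h1 | h1
  · exact absurd h (keyF_lt_of_block σ h1).ne
  · unfold keyF at h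
    rw [h1] at h
    have h2 := (σ _).1.injective (Fin.ext (Nat.add_right_cancel h))
    rw [Prod.mk.injEq] at h2
    have h3 : (ofLex e.2).1 = (ofLex e'.2).1 := by
      apply Fin.ext
      have := congrArg Fin.val h2.1
      omega
    exact Prod.ext h2.1 (ofLex.injective (Prod.ext h3 h2.2))
  · exact absurd h (keyF_lt_of_block σ h1).ne'

lemma keyF_same {m t l : ℕ} (σ : ℕ → RowM m l) (u : ℕ) (hu : u < t) (c c' : Fin m) (j j' : Fin l) :
    keyF m t l σ (c, toLex (⟨u + m - c, by omega⟩, j)) <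
      keyF m t l σ (c', toLex (⟨u + m - c', by omega⟩, j')) ↔
    (σ (u + m)).1 (c, j) < (σ (u + m)).1 (c', j') := by
  have h1 : u + m - c + c = u + m := by have := c.2; omega
  have h2 : u + m - c' + c' = u + m := by have := c'.2; omega
  simp only [keyF, ofLex_toLex, h1, h2]
  rw [Fin.lt_def]
  omega

lemma SYT_lower (m t l : ℕ) (hne : Nonempty (RowM m l)) :
    Nat.card (RowM m l) ^ t ≤ Nat.card (SYT m (m * ((t + m) * l)) (Fin (t + m) ×ₗ Fin l)) := by
  classical
  obtain ⟨σ0⟩ := hne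
  let ext : (Fin t → RowM m l) → ℕ → RowM m l :=
    fun σ s => if h : s - m < t then σ ⟨s - m, h⟩ else σ0
  have hcard : Fintype.card (Fin m × (Fin (t + m) ×ₗ Fin l)) = m * ((t + m) * l) := by
    simp [Fintype.card_lex]
  have hch : ∀ σ : Fin t → RowM m l, ∃ P : SYT m (m * ((t + m) * l)) (Fin (t + m) ×ₗ Fin l),
      ∀ a b, P.1 a < P.1 b ↔ keyF m t l (ext σ) a < keyF m t l (ext σ) b := by
    intro σ
    obtain ⟨P, hP⟩ := exists_rank_equiv hcard (keyF m t l (ext σ)) (keyF_inj _)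
    refine ⟨⟨P, ?_, ?_⟩, hP⟩
    · intro c j j' hj
      refine (hP _ _).mpr ?_
      rcases Prod.Lex.lt_iff.mp hj with h | ⟨h1, h2⟩
      · apply keyF_lt_of_block
        simpa using h
      · unfold keyF
        simp only [h1]
        have := (ext σ ((ofLex j').1.val + c.val)).2 c h2
        rw [Fin.lt_def] at this
        simp only at this
        omega
    · intro j c c' hc
      refine (hP _ _).mpr (keyF_lt_of_block _ ?_)
      simpa using hc
  choose F hF using hch
  have hinj : Function.Injective F := by
    intro σ τ h
    funext u
    have hu : ∀ ρ : Fin t → RowM m l, ext ρ (u.val + m) = ρ u := by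
      intro ρ; simp [ext]
    refine Subtype.ext (equiv_ext_of_order ?_)
    rintro ⟨c, j⟩ ⟨c', j'⟩
    rw [← hu σ, ← hu τ, ← keyF_same (ext σ) u.val u.2, ← keyF_same (ext τ) u.val u.2,
      ← hF, ← hF, h]
  have := Nat.card_le_card_of_injective F hinj
  simpa [Nat.card_fun] using this

lemma colN_lower (m t l : ℕ) (hm : 1 ≤ m) (hl : 1 ≤ l) :
    (Nat.card (RowM m l) ^ t) ^ 2 ≤ colN m (m * ((t + m) * l)) := by
  have hne : Nonempty (RowM m l) := by
    have := RowM_lower m l hl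
    have h2 : 0 < m ^ (m * l) := pow_pos hm _
    have h3 : 0 < Nat.card (RowM m l) := by
      by_contra h
      have : Nat.card (RowM m l) = 0 := by omega
      simp_all
    exact (Nat.card_pos_iff.mp h3).1
  exact (Nat.pow_le_pow_left (SYT_lower m t l hne) 2).trans (SYT_sq_le _ _ _)

lemma root_tendsto (a : ℕ → ℝ) (X : ℝ) (hX : 0 < X)
    (hup : ∀ w > X, ∀ᶠ n in Filter.atTop, a n ≤ w ^ n)
    (hlo : ∀ y, 0 < y → y < X → ∀ᶠ n in Filter.atTop, y ^ n ≤ a n) :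
    Filter.Tendsto (fun n : ℕ => a n ^ (1 / (n : ℝ))) Filter.atTop (nhds X) := by
  have hlo' : ∀ y, 0 < y → y < X → ∀ᶠ n : ℕ in Filter.atTop, y ≤ a n ^ (1 / (n : ℝ)) := by
    intro y hy hyX
    filter_upwards [hlo y hy hyX, Filter.eventually_ge_atTop 1] with n h hn
    have : (y ^ n) ^ (1 / (n : ℝ)) ≤ a n ^ (1 / (n : ℝ)) :=
      Real.rpow_le_rpow (by positivity) h (by positivity)
    rw [one_div, Real.pow_rpow_inv_natCast hy.le (by omega)] at this
    rwa [one_div]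
  rw [tendsto_order]
  constructor
  · intro y hy
    have h1 : max y 0 < X := max_lt hy hX
    obtain ⟨z, hz1, hz2⟩ := exists_between h1
    filter_upwards [hlo' z ((le_max_right _ _).trans_lt hz1) hz2] with n hn
    exact ((le_max_left _ _).trans_lt hz1).trans_le hn
  · intro w hw
    obtain ⟨z, hz1, hz2⟩ := exists_between hw
    have hz0 : 0 < z := hX.trans hz1
    filter_upwards [hup z hz1, hlo (X / 2) (by positivity) (by linarith),
      Filter.eventually_ge_atTop 1] with n h h' hn
    have h0 : 0 ≤ a n := le_trans (by positivity) h'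
    have : a n ^ (1 / (n : ℝ)) ≤ (z ^ n) ^ (1 / (n : ℝ)) :=
      Real.rpow_le_rpow h0 h (by positivity)
    rw [one_div, Real.pow_rpow_inv_natCast hz0.le (by omega)] at this
    rw [one_div]
    exact this.trans_lt hz2

/-- polynomial against exponential -/
lemma poly_exp (d : ℕ) {x w : ℝ} (hx : 0 < x) (hw : x < w) (C : ℝ) (hC : 0 < C) :
    ∀ᶠ n : ℕ in Filter.atTop, C * (n : ℝ) ^ d * x ^ n ≤ w ^ n := by
  have hw0 : 0 < w := hx.trans hw
  have h := tendsto_pow_const_mul_const_pow_of_lt_one d (r := x / w) (by positivity)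
    ((div_lt_one hw0).mpr hw)
  have h2 := h.eventually (gt_mem_nhds (show (0 : ℝ) < 1 / C by positivity))
  filter_upwards [h2] with n hn
  rw [div_pow, ← mul_div_assoc, div_lt_div_iff₀ (by positivity) hC] at hn
  nlinarith

theorem stmt2 (k i : ℕ) (hk : 3 ≤ k) (hi1 : 2 ≤ i) (hi2 : i ≤ k - 1) :
    Filter.Tendsto (fun n : ℕ => (avSet n (Aki k i) : ℝ) ^ (1 / (n : ℝ)))
      Filter.atTop (nhds (((k : ℝ) - 2) ^ 2)) := by
  obtain ⟨m, rfl⟩ : ∃ m, k = m + 2 := ⟨k - 2, by omega⟩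
  have hm : 1 ≤ m := by omega
  have hm0 : (0 : ℝ) < m := by exact_mod_cast hm
  rw [show ((m + 2 : ℕ) : ℝ) - 2 = m by push_cast; ring]
  refine root_tendsto _ _ (by positivity) ?_ ?_
  · intro w hw
    filter_upwards [poly_exp 4 (by positivity) hw 16 (by norm_num),
      Filter.eventually_ge_atTop 1] with n hn h1
    refine le_trans ?_ hn
    have h2 : (avSet n (Aki (m + 2) i) : ℝ) ≤ ((n : ℝ) + 1) ^ 4 * ((m : ℝ) ^ 2) ^ n := by
      exact_mod_cast av_upper (n := n) hi1 hi2
    refine h2.trans (mul_le_mul_of_nonneg_right ?_ (by positivity))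
    have h3 : (1 : ℝ) ≤ n := by exact_mod_cast h1
    calc ((n : ℝ) + 1) ^ 4 ≤ (2 * n) ^ 4 := by gcongr; linarith
      _ = 16 * (n : ℝ) ^ 4 := by ring
  · intro y hy hyX
    obtain ⟨z, hz1, hz2⟩ := exists_between hyX
    have hz0 : 0 < z := hy.trans hz1
    obtain ⟨N, hN⟩ := Filter.eventually_atTop.mp (poly_exp (2 * m) hz0 hz2 1 one_pos)
    -- block length
    let l := N + 1
    let L := m * l
    have hL : 1 ≤ L := Nat.mul_pos hm (by omega)
    have hNL : N ≤ L := by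
      have : 1 * l ≤ m * l := Nat.mul_le_mul_right _ hm
      simp only [L, l] at *; omega
    have hL0 : (0 : ℝ) < L := by exact_mod_cast hL
    have hzL := hN L hNL
    have hM : z ^ L ≤ ((Nat.card (RowM m l) : ℝ)) ^ 2 := by
      have h1 : ((m : ℝ) ^ L) ≤ (Nat.card (RowM m l) : ℝ) * (L : ℝ) ^ m := by
        exact_mod_cast RowM_lower m l (by omega)
      have h2 : ((m : ℝ) ^ 2) ^ L ≤ (Nat.card (RowM m l) : ℝ) ^ 2 * (L : ℝ) ^ (2 * m) := by
        calc ((m : ℝ) ^ 2) ^ L = ((m : ℝ) ^ L) ^ 2 := by ring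
          _ ≤ ((Nat.card (RowM m l) : ℝ) * (L : ℝ) ^ m) ^ 2 := by gcongr
          _ = _ := by ring
      have h3 : (0 : ℝ) < (L : ℝ) ^ (2 * m) := by positivity
      refine le_of_mul_le_mul_right ?_ h3
      refine le_trans ?_ h2
      refine le_trans (le_of_eq ?_) hzL
      ring
    let C := L * (m + 1)
    let D : ℝ := (max 1 z) ^ C
    have hD : 0 < D := by positivity
    have hmain : ∀ n : ℕ, L * m ≤ n → z ^ n ≤ (avSet n (Aki (m + 2) i) : ℝ) * D := by
      intro n hn
      have hdm := Nat.div_add_mod n L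
      have hmod := Nat.mod_lt n hL
      have hq : m ≤ n / L := (Nat.le_div_iff_mul_le hL).mpr (by rw [mul_comm]; exact hn)
      obtain ⟨t, ht⟩ : ∃ t, n / L = t + m := ⟨n / L - m, by omega⟩
      rw [ht] at hdm
      have hsize : m * ((t + m) * l) ≤ n := by
        have : m * ((t + m) * l) = L * (t + m) := by simp only [L]; ring
        omega
      have h1 : ((Nat.card (RowM m l) : ℝ) ^ t) ^ 2 ≤ (avSet n (Aki (m + 2) i) : ℝ) := by
        exact_mod_cast (colN_lower m t l hm (by omega)).trans
          ((colN_mono hm hsize).trans (colN_le_avSet (k := m + 2) hk))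
      have h2 : z ^ (L * t) ≤ (avSet n (Aki (m + 2) i) : ℝ) := by
        refine le_trans ?_ h1
        calc z ^ (L * t) = (z ^ L) ^ t := pow_mul _ _ _
          _ ≤ (((Nat.card (RowM m l) : ℝ)) ^ 2) ^ t := by gcongr
          _ = _ := by ring
      have h3 : n = L * t + (L * m + n % L) := by
        have : L * (t + m) = L * t + L * m := by ring
        omega
      have h4 : z ^ (L * m + n % L) ≤ D := by
        calc z ^ (L * m + n % L) ≤ (max 1 z) ^ (L * m + n % L) := by
              gcongr; exact le_max_right _ _
          _ ≤ (max 1 z) ^ C := by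
              refine pow_le_pow_right₀ (le_max_left _ _) ?_
              have : C = L * m + L := by simp only [C]; ring
              omega
      calc z ^ n = z ^ (L * t) * z ^ (L * m + n % L) := by rw [← pow_add, ← h3]
        _ ≤ _ := by gcongr
    filter_upwards [poly_exp 0 hy hz1 D hD, Filter.eventually_ge_atTop (L * m)] with n h1 h2
    have h3 := hmain n h2
    have h4 : D * y ^ n ≤ D * (avSet n (Aki (m + 2) i) : ℝ) := by
      calc D * y ^ n = D * (n : ℝ) ^ 0 * y ^ n := by ring
        _ ≤ z ^ n := h1
        _ ≤ _ := h3
        _ = _ := by ring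
    exact le_of_mul_le_mul_left h4 hD
end

section
/- For all integers k ≥ 3, all i with 2 ≤ i ≤ k-1, and all n ≥ 1, the number of permutations of length n avoiding A_{k,i} satisfies av_n(A_{k,i}) ≤ n^4 · (k-2)^{2n}. -/
namespace AvProof

/-- zero-based rank, defined recursively -/
noncomputable def rk {n : ℕ} (p : Equiv.Perm (Fin n)) (t : Fin n) : ℕ :=
  (Finset.univ.filter (fun s : Fin n => s < t ∧ p s < p t)).attach.sup
    (fun s => rk p s.1 + 1)
termination_by t.val
decreasing_by
  have := s.2
  simp only [Finset.mem_filter] at this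
  exact this.2.1

lemma rk_lt {n : ℕ} (p : Equiv.Perm (Fin n)) {s t : Fin n} (h : s < t) (hp : p s < p t) :
    rk p s < rk p t := by
  rw [rk.eq_1 p t]
  have hm : s ∈ Finset.univ.filter (fun s : Fin n => s < t ∧ p s < p t) := by simp [h, hp]
  exact Finset.le_sup (f := fun s : {x // x ∈ Finset.univ.filter
    (fun s : Fin n => s < t ∧ p s < p t)} => rk p s.1 + 1) (Finset.mem_attach _ ⟨s, hm⟩)

lemma rk_pred {n : ℕ} (p : Equiv.Perm (Fin n)) {t : Fin n} {m : ℕ} (h : rk p t = m + 1) :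
    ∃ s, s < t ∧ p s < p t ∧ rk p s = m := by
  rw [rk.eq_1 p t] at h
  have hne : (Finset.univ.filter (fun s : Fin n => s < t ∧ p s < p t)).attach.Nonempty := by
    by_contra hc
    rw [Finset.not_nonempty_iff_eq_empty] at hc
    rw [hc] at h
    simp at h
  obtain ⟨s, -, hs⟩ := Finset.exists_mem_eq_sup _ hne
    (fun s : {x // x ∈ Finset.univ.filter
    (fun s : Fin n => s < t ∧ p s < p t)} => rk p s.1 + 1)
  have h2 := s.2
  simp only [Finset.mem_filter] at h2
  refine ⟨s.1, h2.2.1, h2.2.2, ?_⟩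
  rw [hs] at h
  omega

/-- chain of length `m+1` -/
def Chain {n : ℕ} (p : Equiv.Perm (Fin n)) (m : ℕ) (g : ℕ → Fin n) : Prop :=
  ∀ a b, a < b → b ≤ m → g a < g b ∧ p (g a) < p (g b)

lemma exists_chain {n : ℕ} (p : Equiv.Perm (Fin n)) (m : ℕ) : ∀ t : Fin n, rk p t = m →
    ∃ g : ℕ → Fin n, Chain p m g ∧ g m = t ∧ ∀ a ≤ m, rk p (g a) = a := by
  induction m with
  | zero =>
    intro t ht
    refine ⟨fun _ => t, fun a b h1 h2 => by omega, rfl, fun a ha => ?_⟩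
    simp only [ht]; omega
  | succ m ih =>
    intro t ht
    obtain ⟨s, h1, h2, h3⟩ := rk_pred p ht
    obtain ⟨g, hg, hgm, hgr⟩ := ih s h3
    refine ⟨fun a => if a ≤ m then g a else t, ?_, by simp, ?_⟩
    · intro a b hab hb
      have ha : a ≤ m := by omega
      by_cases hbm : b ≤ m
      · simp only [ha, hbm, if_true]
        exact hg a b hab hbm
      · simp only [ha, hbm, if_true, if_false]
        rcases Nat.lt_or_ge a m with h | h
        · have := hg a m h le_rfl
          rw [hgm] at this
          exact ⟨this.1.trans h1, this.2.trans h2⟩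
        · have : a = m := by omega
          subst this
          rw [hgm]; exact ⟨h1, h2⟩
    · intro a ha
      by_cases ham : a ≤ m
      · simp only [ham, if_true]; exact hgr a ham
      · simp only [ham, if_false]; omega

lemma standardize {n k : ℕ} (w : Fin k → Fin n) (hw : Function.Injective w) :
    ∃ q : Equiv.Perm (Fin k), ∀ r s, q r < q s ↔ w r < w s := by
  refine ⟨(Tuple.sort w)⁻¹, fun r s => ?_⟩
  have hm : StrictMono (w ∘ Tuple.sort w) :=
    (Tuple.monotone_sort w).strictMono_of_injective (hw.comp (Tuple.sort w).injective)
  have := hm.lt_iff_lt (a := (Tuple.sort w)⁻¹ r) (b := (Tuple.sort w)⁻¹ s)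
  simpa using this.symm

lemma key {n k i : ℕ} (hk : 3 ≤ k) (hi1 : 2 ≤ i) (hi2 : i ≤ k - 1)
    (p : Equiv.Perm (Fin n)) (hp : AvoidsSet p (Aki k i)) (g : ℕ → Fin n)
    (hg : Chain p (k - 2) g) (y : Fin n) (hy : g (k - 2) < y) :
    p (g (i - 2)) < p y ∧ p y < p (g (i - 1)) := by
  by_contra hcon
  have hgy : ∀ a ≤ k - 2, g a < y := by
    intro a ha
    rcases Nat.lt_or_ge a (k - 2) with h | h
    · exact (hg a _ h le_rfl).1.trans hy
    · have : a = k - 2 := by omega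
      rw [this]; exact hy
  let f : Fin k → Fin n := fun r => if (r : ℕ) ≤ k - 2 then g r else y
  have hf : StrictMono f := by
    intro r s hrs
    have hrs' : (r : ℕ) < s := hrs
    have := s.2
    have hr : (r : ℕ) ≤ k - 2 := by omega
    by_cases hs : (s : ℕ) ≤ k - 2
    · simp only [f, hr, hs, if_true]; exact (hg _ _ hrs' hs).1
    · simp only [f, hr, hs, if_true, if_false]; exact hgy _ hr
  obtain ⟨q, hq⟩ := standardize (p ∘ f) (p.injective.comp hf.injective)
  have hlast : ∀ j : Fin k, (j : ℕ) = k - 1 → f j = y := by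
    intro j hj
    have : ¬ (j : ℕ) ≤ k - 2 := by omega
    simp only [f, this, if_false]
  refine hp q ⟨?_, ?_⟩ ⟨f, hf, hq⟩
  · intro r s hrs hs
    rw [hq]
    have h1 : (r : ℕ) ≤ k - 2 := by omega
    have h2 : (s : ℕ) ≤ k - 2 := by omega
    simp only [Function.comp, f, h1, h2, if_true]
    exact (hg _ _ hrs h2).2
  · intro j hj hqj
    have hcard : (Finset.univ.filter (fun s => q s < q j)).card = i - 1 := by
      have : (Finset.univ.filter (fun s => q s < q j)).map q.toEmbedding
          = Finset.Iio (q j) := by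
        ext x
        simp only [Finset.mem_map, Finset.mem_filter, Finset.mem_univ, true_and,
          Finset.mem_Iio, Equiv.coe_toEmbedding]
        constructor
        · rintro ⟨a, ha, rfl⟩; exact ha
        · intro hx; exact ⟨q.symm x, by simpa using hx, by simp⟩
      rw [← Finset.card_map q.toEmbedding, this, Fin.card_Iio, hqj]
    apply hcon
    constructor
    · by_contra hlt
      push Not at hlt
      have hsub : Finset.univ.filter (fun s => q s < q j) ⊆
          Finset.Iio (⟨i - 2, by omega⟩ : Fin k) := by
        intro s hs
        simp only [Finset.mem_filter, Finset.mem_univ, true_and, Finset.mem_Iio] at hs ⊢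
        rw [hq] at hs
        simp only [Function.comp, hlast j hj] at hs
        by_contra hge
        have hge' : i - 2 ≤ (s : ℕ) := by simpa [Fin.lt_def] using hge
        by_cases h2 : (s : ℕ) ≤ k - 2
        · simp only [f, h2, if_true] at hs
          rcases Nat.lt_or_ge (i - 2) (s : ℕ) with h | h
          · exact absurd ((hg _ _ h h2).2.trans hs) (not_lt.mpr hlt)
          · have : (s : ℕ) = i - 2 := by omega
            rw [this] at hs
            exact absurd hs (not_lt.mpr hlt)
        · simp only [f, h2, if_false] at hs
          exact lt_irrefl _ hs
      have := Finset.card_le_card hsub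
      rw [hcard, Fin.card_Iio] at this
      simp only at this
      omega
    · by_contra hlt
      push Not at hlt
      have hne : p (g (i - 1)) ≠ p y := fun h =>
        (hgy (i - 1) (by omega)).ne (p.injective h)
      have hlt' : p (g (i - 1)) < p y := lt_of_le_of_ne hlt hne
      have hsub : Finset.Iic (⟨i - 1, by omega⟩ : Fin k) ⊆
          Finset.univ.filter (fun s => q s < q j) := by
        intro s hs
        simp only [Finset.mem_filter, Finset.mem_univ, true_and, Finset.mem_Iic] at hs ⊢
        have hs' : (s : ℕ) ≤ i - 1 := hs
        rw [hq]
        simp only [Function.comp, hlast j hj]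
        have h2 : (s : ℕ) ≤ k - 2 := by omega
        simp only [f, h2, if_true]
        rcases Nat.lt_or_ge (s : ℕ) (i - 1) with h | h
        · exact (hg _ _ h (by omega)).2.trans hlt'
        · have : (s : ℕ) = i - 1 := by omega
          rw [this]; exact hlt'
      have := Finset.card_le_card hsub
      rw [hcard, Fin.card_Iic] at this
      simp only at this
      omega

lemma rk_le {n k i : ℕ} (hk : 3 ≤ k) (hi1 : 2 ≤ i) (hi2 : i ≤ k - 1)
    (p : Equiv.Perm (Fin n)) (hp : AvoidsSet p (Aki k i)) (t : Fin n) : rk p t ≤ k - 2 := by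
  by_contra h
  push Not at h
  obtain ⟨g, hg, -, -⟩ := exists_chain p (rk p t) t rfl
  have h1 := key hk hi1 hi2 p hp g (fun a b hab hb => hg a b hab (by omega)) (g (k - 1))
    (hg _ _ (by omega) (by omega)).1
  exact lt_asymm h1.2 (hg (i - 1) (k - 1) (by omega) (by omega)).2

/-- the colour of a position -/
noncomputable def col {n : ℕ} (k i : ℕ) (p : Equiv.Perm (Fin n)) (t : Fin n) : ℕ :=
  if rk p t < k - 2 then rk p t else i - 2

lemma exists_decoding_data {n k i : ℕ} (hk : 3 ≤ k) (hi1 : 2 ≤ i) (hi2 : i ≤ k - 1) (hn : 1 ≤ n)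
    (p : Equiv.Perm (Fin n)) (hp : AvoidsSet p (Aki k i)) :
    ∃ j q : Fin n, ∀ t s : Fin n, t < s → t ≠ j → s ≠ j → col k i p t = col k i p s →
      (p t < p s ↔ col k i p t = i - 2 ∧ q ≤ t ∧ t < j ∧ j < s) := by
  have hj : ∃ j : Fin n, (∀ t < j, rk p t < k - 2) ∧ (rk p j = k - 2 ∨ ∀ t, t ≤ j) := by
    by_cases h : ∃ t, rk p t = k - 2
    · obtain ⟨j, hj, hm⟩ := WellFounded.has_min (wellFounded_lt (α := Fin n))
        {t | rk p t = k - 2} h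
      refine ⟨j, fun t ht => ?_, Or.inl hj⟩
      exact lt_of_le_of_ne (rk_le hk hi1 hi2 p hp t) (fun he => hm t he ht)
    · push Not at h
      refine ⟨⟨n - 1, by omega⟩, fun t _ =>
        lt_of_le_of_ne (rk_le hk hi1 hi2 p hp t) (h t), Or.inr fun t => ?_⟩
      have := t.2
      rw [Fin.le_def]; simp only; omega
  obtain ⟨j, hj1, hj2⟩ := hj
  -- facts about the part after `j`
  have hR : ∀ y, j < y → i - 1 ≤ rk p y := by
    intro y hy
    rcases hj2 with h | h
    · obtain ⟨g, hg, hgj, hgr⟩ := exists_chain p (k - 2) j h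
      have h1 := (key hk hi1 hi2 p hp g hg y (by rwa [hgj])).1
      have h2 : g (i - 2) < y := by
        have := (hg (i - 2) (k - 2) (by omega) le_rfl).1
        rw [hgj] at this
        exact this.trans hy
      have h3 := rk_lt p h2 h1
      rw [hgr (i - 2) (by omega)] at h3
      omega
    · exact absurd hy (not_lt.mpr (h y))
  have hD : ∀ e, rk p e = i - 2 → (∀ y, j < y → p e < p y) ∨ (∀ y, j < y → p y < p e) := by
    intro e he
    rcases hj2 with h | h
    · obtain ⟨g, hg, hgj, hgr⟩ := exists_chain p (k - 2) j h
      have K : ∀ y, j < y → p (g (i - 2)) < p y ∧ p y < p (g (i - 1)) := fun y hy =>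
        key hk hi1 hi2 p hp g hg y (by rwa [hgj])
      rcases lt_or_ge e (g (i - 1)) with h1 | h1
      · rcases lt_or_ge (p e) (p (g (i - 1))) with h2 | h2
        · left
          intro y hy
          obtain ⟨g', hg', hge, -⟩ := exists_chain p (i - 2) e he
          have := (key hk hi1 hi2 p hp (fun a => if a ≤ i - 2 then g' a else g a) ?_ y ?_).1
          · simpa [hge] using this
          · intro a b hab hb
            by_cases hbi : b ≤ i - 2
            · have hai : a ≤ i - 2 := by omega
              simp only [hai, hbi, if_true]
              exact hg' a b hab hbi
            · by_cases hai : a ≤ i - 2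
              · simp only [hai, hbi, if_true, if_false]
                have A1 : g' a ≤ e ∧ p (g' a) ≤ p e := by
                  rcases Nat.lt_or_ge a (i - 2) with h | h
                  · have := hg' a (i - 2) h le_rfl
                    rw [hge] at this
                    exact ⟨this.1.le, this.2.le⟩
                  · have : a = i - 2 := by omega
                    rw [this, hge]; exact ⟨le_rfl, le_rfl⟩
                have A2 : g (i - 1) ≤ g b ∧ p (g (i - 1)) ≤ p (g b) := by
                  rcases Nat.lt_or_ge (i - 1) b with h | h
                  · have := hg (i - 1) b h hb
                    exact ⟨this.1.le, this.2.le⟩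
                  · have : b = i - 1 := by omega
                    rw [this]; exact ⟨le_rfl, le_rfl⟩
                exact ⟨A1.1.trans_lt (h1.trans_le A2.1), A1.2.trans_lt (h2.trans_le A2.2)⟩
              · simp only [hai, hbi, if_false]
                exact hg a b hab hb
          · have : ¬ (k - 2 ≤ i - 2) := by omega
            simp only [this, if_false]
            rwa [hgj]
        · right
          intro y hy
          exact (K y hy).2.trans_le h2
      · left
        intro y hy
        refine lt_of_le_of_lt ?_ (K y hy).1
        by_contra hc
        push Not at hc
        have h3 := rk_lt p ((hg (i - 2) (i - 1) (by omega) (by omega)).1.trans_le h1) hc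
        rw [hgr (i - 2) (by omega), he] at h3
        exact lt_irrefl _ h3
    · left
      intro y hy
      exact absurd hy (not_lt.mpr (h y))
  have hq : ∃ q : Fin n, ∀ e, rk p e = i - 2 →
      (e < q → ∀ y, j < y → p y < p e) ∧ (q ≤ e → ∀ y, j < y → p e < p y) := by
    by_cases hS : ∃ e, rk p e = i - 2 ∧ ∀ y, j < y → p e < p y
    · obtain ⟨q, hq, hm⟩ := WellFounded.has_min (wellFounded_lt (α := Fin n))
        {e | rk p e = i - 2 ∧ ∀ y, j < y → p e < p y} hS
      refine ⟨q, fun e he => ⟨fun h => ?_, fun h y hy => ?_⟩⟩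
      · rcases hD e he with h' | h'
        · exact absurd h (hm e ⟨he, h'⟩)
        · exact h'
      · refine lt_of_le_of_lt ?_ (hq.2 y hy)
        rcases h.lt_or_eq with h | h
        · by_contra hc
          push Not at hc
          have := rk_lt p h hc
          rw [he, hq.1] at this
          exact lt_irrefl _ this
        · rw [h]
    · have hno : ∀ y, ¬ j < y := by
        intro y hy
        rcases hj2 with h | h
        · obtain ⟨g, hg, hgj, hgr⟩ := exists_chain p (k - 2) j h
          exact hS ⟨g (i - 2), hgr _ (by omega), fun z hz =>
            (key hk hi1 hi2 p hp g hg z (by rwa [hgj])).1⟩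
        · exact absurd hy (not_lt.mpr (h y))
      exact ⟨j, fun e _ => ⟨fun _ y hy => absurd hy (hno y), fun _ y hy => absurd hy (hno y)⟩⟩
  obtain ⟨q, hq⟩ := hq
  refine ⟨j, q, fun t s hts htj hsj hc => ⟨fun hlt => ?_, ?_⟩⟩
  · have h1 := rk_lt p hts hlt
    have h2 := rk_le hk hi1 hi2 p hp s
    have h3 : rk p s = k - 2 ∧ rk p t = i - 2 := by
      unfold col at hc
      split_ifs at hc <;> omega
    have hjs : j < s := by
      rcases lt_or_ge s j with h | h
      · have := hj1 s h; omega
      · exact lt_of_le_of_ne h (Ne.symm hsj)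
    have htj' : t < j := by
      rcases lt_or_ge t j with h | h
      · exact h
      · have := hR t (lt_of_le_of_ne h (Ne.symm htj)); omega
    refine ⟨?_, ?_, htj', hjs⟩
    · unfold col; split_ifs <;> omega
    · by_contra hqt
      push Not at hqt
      exact lt_asymm hlt ((hq t h3.2).1 hqt s hjs)
  · rintro ⟨h1, h2, h3, h4⟩
    have h5 := hj1 t h3
    have h6 : rk p t = i - 2 := by
      unfold col at h1
      rwa [if_pos h5] at h1
    exact (hq t h6).2 h2 s h4

lemma perm_eq_one {n : ℕ} {γ : Type*} (σ : Equiv.Perm (Fin n)) (c : Fin n → γ)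
    (hc : ∀ w, c (σ w) = c w) (hm : ∀ w w', c w = c w' → w < w' → σ w < σ w') (w : Fin n) :
    σ w = w := by
  induction w using WellFoundedLT.induction with
  | ind w ih =>
    rcases lt_trichotomy (σ w) w with h | h | h
    · exact σ.injective (ih _ h)
    · exact h
    · exfalso
      have e : σ (σ.symm w) = w := by simp
      rcases lt_trichotomy (σ.symm w) w with h' | h' | h'
      · have := ih _ h'
        rw [e] at this
        exact h'.ne this.symm
      · rw [h'] at e
        exact h.ne e.symm
      · have h2 := hm w (σ.symm w) (by rw [← hc (σ.symm w), e]) h'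
        rw [e] at h2
        exact lt_asymm h h2

end AvProof

open AvProof

/-- For `2 ≤ i ≤ k-1`, `av_n(A_{k,i}) ≤ n⁴ (k-2)^{2n}`. -/
theorem stmt3 (k i n : ℕ) (hk : 3 ≤ k) (hi1 : 2 ≤ i) (hi2 : i ≤ k - 1) (hn : 1 ≤ n) :
    avSet n (Aki k i) ≤ n ^ 4 * (k - 2) ^ (2 * n) := by
  have hcol : ∀ (p : Equiv.Perm (Fin n)) t, col k i p t < k - 2 := by
    intro p t
    unfold col
    split_ifs <;> omega
  choose J Q hJQ using fun P : { p : Equiv.Perm (Fin n) // AvoidsSet p (Aki k i) } =>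
    exists_decoding_data hk hi1 hi2 hn P.1 P.2
  let F : { p : Equiv.Perm (Fin n) // AvoidsSet p (Aki k i) } →
      Fin n × Fin n × Fin n × (Fin n → Fin (k - 2)) × (Fin n → Fin (k - 2)) :=
    fun P => (J P, Q P, P.1 (J P), fun t => ⟨col k i P.1 t, hcol _ _⟩,
      fun w => ⟨col k i P.1 (P.1.symm w), hcol _ _⟩)
  have hF : Function.Injective F := by
    intro P P' h
    simp only [F, Prod.mk.injEq] at h
    obtain ⟨h1, h2, h3, h4, h5⟩ := h
    have h4' : ∀ t, col k i P.1 t = col k i P'.1 t := fun t => by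
      simpa using congrFun h4 t
    have h5' : ∀ w, col k i P.1 (P.1.symm w) = col k i P'.1 (P'.1.symm w) := fun w => by
      simpa using congrFun h5 w
    have H := hJQ P
    have H' := hJQ P'
    rw [← h1] at H' h3
    rw [← h2] at H'
    generalize J P = j at *
    generalize Q P = q at *
    obtain ⟨p, hp⟩ := P
    obtain ⟨p', hp'⟩ := P'
    simp only at *
    have hlt : ∀ t s, t ≠ j → s ≠ j → col k i p t = col k i p s → p t < p s → p' t < p' s := by
      intro t s ht hs hc hlt
      rcases lt_trichotomy t s with h | h | h
      · rw [H' t s h ht hs (by rw [← h4', ← h4', hc]), ← h4']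
        exact (H t s h ht hs hc).1 hlt
      · rw [h] at hlt; exact absurd hlt (lt_irrefl _)
      · have hn1 : ¬ p s < p t := lt_asymm hlt
        rw [H s t h hs ht hc.symm, h4'] at hn1
        rw [← H' s t h hs ht (by rw [← h4', ← h4', hc])] at hn1
        exact lt_of_le_of_ne (not_lt.mp hn1) (fun e => h.ne' (p'.injective e))
    apply Subtype.ext
    simp only
    ext1 t
    have := perm_eq_one (p.symm.trans p')
      (fun w => (col k i p (p.symm w), decide (p.symm w = j))) ?_ ?_ (p t)
    · simpa using this.symm
    · intro w
      have e1 : col k i p (p.symm (p' (p.symm w))) = col k i p (p.symm w) := by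
        rw [h5']; simp [h4']
      have e2 : p.symm (p' (p.symm w)) = j ↔ p.symm w = j := by
        rw [Equiv.symm_apply_eq, h3, p'.injective.eq_iff]
      simp [e1, e2]
    · intro w w' hc hw
      simp only [Prod.mk.injEq, decide_eq_decide] at hc
      obtain ⟨hc1, hc2⟩ := hc
      simp only [Equiv.trans_apply]
      have hne : p.symm w ≠ j := by
        intro h
        have h' := hc2.1 h
        exact hw.ne (p.symm.injective (h.trans h'.symm))
      exact hlt _ _ hne (fun h => hne (hc2.2 h)) hc1 (by simpa using hw)
  have hcard := Nat.card_le_card_of_injective F hF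
  unfold avSet
  refine hcard.trans ?_
  simp only [Nat.card_eq_fintype_card, Fintype.card_prod, Fintype.card_fin, Fintype.card_fun]
  have e : n * (n * (n * ((k - 2) ^ n * (k - 2) ^ n))) = n ^ 3 * (k - 2) ^ (2 * n) := by ring
  rw [e]
  exact Nat.mul_le_mul_right _ (Nat.pow_le_pow_right hn (by norm_num))
end

section
/- A permutation is determined by its two rank words: if p = p_1 ⋯ p_n and q = q_1 ⋯ q_n are permutations of length n such that for every position j the rank of p_j in p equals the rank of q_j in q, and for every value t ∈ {1,…,n} the rank of the entry equal to t in p equals the rank of the entry equal to t in q, then p = q. Equivalently, the map sending p to the pair of words (w(p), z(p)), where the j-th letter of w(p) is the rank of p_j and the t-th letter of z(p) is the rank of the entry of p with value t, is injective on permutations of length n. -/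
theorem rank_bdd {n : ℕ} (p : Equiv.Perm (Fin n)) (j : Fin n) :
    BddAbove { m : ℕ | ∃ f : Fin m → Fin n, StrictMono f ∧ StrictMono (p ∘ f) ∧
    (∀ r, f r ≤ j) ∧ (∃ r, f r = j) } := by
  refine ⟨n, ?_⟩
  rintro m ⟨f, hf, -⟩
  simpa using Fintype.card_le_of_injective f hf.injective

theorem rank_lt {n : ℕ} (p : Equiv.Perm (Fin n)) {i j : Fin n} (hij : i < j)
    (hp : p i < p j) : rank p i < rank p j := by
  have hne : { m : ℕ | ∃ f : Fin m → Fin n, StrictMono f ∧ StrictMono (p ∘ f) ∧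
      (∀ r, f r ≤ i) ∧ (∃ r, f r = i) }.Nonempty :=
    ⟨1, fun _ => i, Subsingleton.strictMono _, Subsingleton.strictMono _,
      fun _ => le_rfl, 0, rfl⟩
  have hmem : ∃ f : Fin (rank p i) → Fin n, StrictMono f ∧ StrictMono (p ∘ f) ∧
      (∀ r, f r ≤ i) ∧ (∃ r, f r = i) := Nat.sSup_mem hne (rank_bdd p i)
  obtain ⟨f, hf, hpf, hle, r0, hr0⟩ := hmem
  have hpl : ∀ r, p (f r) ≤ p i := by
    intro r
    rw [← hr0]
    refine hpf.monotone (hf.le_iff_le.1 ?_)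
    rw [hr0]
    exact hle r
  refine Nat.lt_of_succ_le (le_csSup (rank_bdd p j) ?_)
  refine ⟨Fin.snoc (α := fun _ => Fin n) f j, ?_, ?_, ?_, Fin.last _, by simp⟩
  · intro a b hab
    induction b using Fin.lastCases with
    | last =>
      induction a using Fin.lastCases with
      | last => exact absurd hab (lt_irrefl _)
      | cast a => simpa using (hle a).trans_lt hij
    | cast b =>
      induction a using Fin.lastCases with
      | last => exact absurd hab (not_lt.2 (Fin.le_last _))
      | cast a => simpa using hf (by simpa using hab)
  · intro a b hab
    induction b using Fin.lastCases with
    | last =>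
      induction a using Fin.lastCases with
      | last => exact absurd hab (lt_irrefl _)
      | cast a => simpa using (hpl a).trans_lt hp
    | cast b =>
      induction a using Fin.lastCases with
      | last => exact absurd hab (not_lt.2 (Fin.le_last _))
      | cast a => simpa using hpf (show a < b by simpa using hab)
  · intro a
    induction a using Fin.lastCases with
    | last => simp
    | cast a => simpa using (hle a).trans hij.le

theorem not_lt_aux {n : ℕ} (p q : Equiv.Perm (Fin n))
    (hw : ∀ j : Fin n, rank p j = rank q j)
    (hz : ∀ t : Fin n, rank p (p.symm t) = rank q (q.symm t)) (j : Fin n)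
    (ih : ∀ i < j, p i = q i) : ¬ p j < q j := by
  intro h
  have hk : p (p.symm (q j)) = q j := by simp
  have h1 := hz (q j)
  rw [Equiv.symm_apply_apply] at h1
  generalize p.symm (q j) = k at hk h1
  rcases lt_trichotomy k j with hlt | rfl | hgt
  · have := ih k hlt
    rw [hk] at this
    exact hlt.ne (q.injective this).symm
  · exact h.ne hk
  · have := rank_lt p hgt (hk ▸ h)
    rw [h1, hw j] at this
    exact lt_irrefl _ this

/-- A permutation is determined by its two rank words `w(p)` and `z(p)`. -/
theorem stmt5 {n : ℕ} (p q : Equiv.Perm (Fin n))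
    (hw : ∀ j : Fin n, rank p j = rank q j)
    (hz : ∀ t : Fin n, rank p (p.symm t) = rank q (q.symm t)) :
    p = q := by
  have key : ∀ j : Fin n, p j = q j := by
    intro j
    induction j using WellFoundedLT.induction with
    | ind j ih =>
      exact le_antisymm
        (not_lt.1 (not_lt_aux q p (fun j => (hw j).symm) (fun t => (hz t).symm) j
          (fun i hi => (ih i hi).symm)))
        (not_lt.1 (not_lt_aux p q hw hz j ih))
  exact Equiv.ext key
end

section
/- For all positive integers n and all integers k ≥ 3, the number of permutations of length n avoiding A_{k,k-1} is at most the number of permutations of length n avoiding A_{k,k}: av_n(A_{k,k-1}) ≤ av_n(A_{k,k}). -/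
/-- There is an increasing subsequence of length `m+2` of `p` ending at position `j`. -/
def BadPos (m : ℕ) {n : ℕ} (p : Equiv.Perm (Fin n)) (j : Fin n) : Prop :=
  ∃ c : Fin (m + 2) → Fin n, StrictMono c ∧ StrictMono (p ∘ c) ∧ c (Fin.last (m + 1)) = j

/-- The set of bad positions, together with the sentinel `n`. -/
def badSet (m : ℕ) {n : ℕ} (p : Equiv.Perm (Fin n)) : Set ℕ :=
  {t | t = n ∨ ∃ h : t < n, BadPos m p ⟨t, h⟩}

/-- The first bad position, or `n` if there is none. -/
noncomputable def firstBad (m : ℕ) {n : ℕ} (p : Equiv.Perm (Fin n)) : ℕ := sInf (badSet m p)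

/-- Reverse the positions from `a` on. -/
def revFun (n a : ℕ) (i : Fin n) : Fin n :=
  if h : (i : ℕ) < a then i else ⟨a + (n - 1) - i, by have := i.2; omega⟩

lemma revFun_invol (n a : ℕ) : Function.Involutive (revFun n a) := by
  intro i
  have hi := i.2
  by_cases h : (i : ℕ) < a
  · simp [revFun, h]
  · have h2 : ¬ (a + (n - 1) - (i : ℕ) < a) := by omega
    apply Fin.ext
    simp only [revFun, h, h2, dite_false]
    omega

/-- The reversal as a permutation. -/
def revPerm (n a : ℕ) : Equiv.Perm (Fin n) := (revFun_invol n a).toPerm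

lemma revPerm_lt {n a : ℕ} {i : Fin n} (h : (i : ℕ) < a) : revPerm n a i = i := by
  change revFun n a i = i
  simp [revFun, h]

lemma revPerm_ge {n a : ℕ} {i : Fin n} (h : a ≤ (i : ℕ)) :
    (revPerm n a i : ℕ) = a + (n - 1) - i := by
  change ((revFun n a i : Fin n) : ℕ) = _
  have : ¬ ((i : ℕ) < a) := by omega
  simp [revFun, this]

lemma update_strictMono {α : Type*} [Preorder α] {m : ℕ} {c : Fin (m + 2) → α}
    (hc : StrictMono c) {x : α} (hx : c (Fin.last m).castSucc < x) :
    StrictMono (Function.update c (Fin.last (m + 1)) x) := by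
  intro r s hrs
  have hr : r ≠ Fin.last (m + 1) := (lt_of_lt_of_le hrs (Fin.le_last s)).ne
  rw [Function.update_of_ne hr]
  by_cases hs : s = Fin.last (m + 1)
  · subst hs
    rw [Function.update_self]
    refine lt_of_le_of_lt (hc.monotone ?_) hx
    rw [Fin.le_def]
    rw [Fin.lt_def] at hrs
    simp at hrs ⊢
    omega
  · rw [Function.update_of_ne hs]
    exact hc hrs

/-- Standardization of an injective word. -/
lemma exists_pattern {n k : ℕ} (g : Fin k → Fin n) (hg : Function.Injective g) :
    ∃ q : Equiv.Perm (Fin k), ∀ r s, q r < q s ↔ g r < g s := by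
  have hs : StrictMono (g ∘ Tuple.sort g) :=
    (Tuple.monotone_sort g).strictMono_of_injective (hg.comp (Tuple.sort g).injective)
  refine ⟨(Tuple.sort g).symm, fun r s => ?_⟩
  have := hs.lt_iff_lt (a := (Tuple.sort g).symm r) (b := (Tuple.sort g).symm s)
  simp at this
  exact this.symm

/-- A pattern of `A_k` with its last two entries increasing ends in `k`. -/
lemma last_of_lt {m : ℕ} {q : Equiv.Perm (Fin (m + 3))} (hq : q ∈ Ak (m + 3))
    (h : q (Fin.last (m + 1)).castSucc < q (Fin.last (m + 2))) :
    (q (Fin.last (m + 2)) : ℕ) = m + 2 := by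
  have hmono : StrictMono q := by
    rw [Fin.strictMono_iff_lt_succ]
    intro i
    by_cases hi : (i : ℕ) < m + 1
    · apply hq
      · simp
      · simp; omega
    · have : i = Fin.last (m + 1) := by
        apply Fin.ext; simp; omega
      subst this
      exact h
  have := hmono.le_apply (x := Fin.last (m + 2))
  rw [Fin.le_def] at this
  have h2 := (q (Fin.last (m + 2))).2
  rw [Fin.val_last] at this
  omega

lemma key {m n : ℕ} {p : Equiv.Perm (Fin n)} (hp : AvoidsSet p (Aki (m + 3) (m + 3 - 1)))
    {c : Fin (m + 2) → Fin n} (hc : StrictMono c) (hpc : StrictMono (p ∘ c)) {x : Fin n}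
    (hx : c (Fin.last (m + 1)) < x) :
    p (c (Fin.last m).castSucc) < p x ∧ p x < p (c (Fin.last (m + 1))) := by
  let f : Fin (m + 3) → Fin n := Fin.snoc (α := fun _ => Fin n) c x
  have f1 : ∀ i : Fin (m + 2), f i.castSucc = c i := fun i => by simp [f]
  have f2 : f (Fin.last (m + 2)) = x := by simp [f]
  have hf : StrictMono f := by
    rw [Fin.strictMono_iff_lt_succ]
    intro i
    rw [f1]
    induction i using Fin.lastCases with
    | last => rw [Fin.succ_last, f2]; exact hx
    | cast i => rw [Fin.succ_castSucc, f1]; exact hc (by simp [Fin.lt_def])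
  obtain ⟨q, hq⟩ := exists_pattern (p ∘ f) (p.injective.comp hf.injective)
  have hA : q ∈ Ak (m + 3) := by
    intro r s hrs hs
    have hs' : (s : ℕ) < m + 2 := by omega
    have hr' : (r : ℕ) < m + 2 := by omega
    rw [hq]
    have er : r = Fin.castSucc ⟨r, hr'⟩ := rfl
    have es : s = Fin.castSucc ⟨s, hs'⟩ := rfl
    rw [er, es]
    simp only [Function.comp, f1]
    exact hpc (Fin.lt_def.2 hrs)
  have hlast : (q (Fin.last (m + 2)) : ℕ) = m + 1 := by
    by_contra hne
    refine hp q ⟨hA, ?_⟩ ⟨f, hf, hq⟩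
    intro j hj
    have : j = Fin.last (m + 2) := Fin.ext (by simpa using hj)
    subst this
    simpa using hne
  have hne1 : q (Fin.last (m + 1)).castSucc ≠ q (Fin.last (m + 2)) := by
    intro h
    have := congrArg Fin.val (q.injective h)
    simp at this
  have hlt1 : q (Fin.last (m + 2)) < q (Fin.last (m + 1)).castSucc := by
    rcases lt_or_gt_of_ne hne1 with h | h
    · have := last_of_lt hA h
      omega
    · exact h
  have hne2 : q (Fin.last m).castSucc.castSucc ≠ q (Fin.last (m + 2)) := by
    intro h
    have := congrArg Fin.val (q.injective h)
    simp at this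
  have hlt2 : q (Fin.last m).castSucc.castSucc < q (Fin.last (m + 1)).castSucc := by
    apply hA <;> simp
  have hlt3 : q (Fin.last m).castSucc.castSucc < q (Fin.last (m + 2)) := by
    have b := (q (Fin.last (m + 1)).castSucc).2
    rw [Fin.lt_def] at hlt1 hlt2 ⊢
    have : (q (Fin.last m).castSucc.castSucc : ℕ) ≠ q (Fin.last (m + 2)) :=
      fun h => hne2 (Fin.ext h)
    omega
  rw [hq] at hlt1 hlt3
  simp only [Function.comp, f1, f2] at hlt1 hlt3
  exact ⟨hlt3, hlt1⟩

lemma firstBad_mem (m : ℕ) {n : ℕ} (p : Equiv.Perm (Fin n)) : firstBad m p ∈ badSet m p :=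
  Nat.sInf_mem ⟨n, Or.inl rfl⟩

lemma firstBad_le (m : ℕ) {n : ℕ} (p : Equiv.Perm (Fin n)) {t : ℕ} (h : t ∈ badSet m p) :
    firstBad m p ≤ t := Nat.sInf_le h

lemma dec {m n : ℕ} {p : Equiv.Perm (Fin n)} (hp : AvoidsSet p (Aki (m + 3) (m + 3 - 1)))
    {i i' : Fin n} (hi : firstBad m p ≤ (i : ℕ)) (h : i < i') : p i' < p i := by
  rcases firstBad_mem m p with h0 | ⟨hlt, c, hc, hpc, hcl⟩
  · have := i.2
    omega
  have hle : c (Fin.last (m + 1)) ≤ i := by rw [hcl]; exact hi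
  rcases hle.eq_or_lt with e | l
  · rw [← e] at h ⊢
    exact (key hp hc hpc h).2
  · have h1 := (key hp hc hpc l).1
    have hcc : c (Fin.last m).castSucc < c (Fin.last (m + 1)) := hc (by simp [Fin.lt_def])
    have u1 := update_strictMono hc (hcc.trans l)
    have u2 := update_strictMono hpc (x := p i) h1
    rw [← Function.comp_update] at u2
    have := (key hp u1 u2 (x := i') (by simpa using h)).2
    simpa using this

/-- The map reversing everything from the first bad position on. -/
noncomputable def phi (m : ℕ) {n : ℕ} (p : Equiv.Perm (Fin n)) : Equiv.Perm (Fin n) :=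
  (revPerm n (firstBad m p)).trans p

lemma phi_apply (m : ℕ) {n : ℕ} (p : Equiv.Perm (Fin n)) (i : Fin n) :
    phi m p i = p (revPerm n (firstBad m p) i) := rfl

lemma bad_of_phi {m n : ℕ} {p : Equiv.Perm (Fin n)} {j : Fin n} (hj : BadPos m (phi m p) j) :
    firstBad m p ≤ (j : ℕ) := by
  by_contra! hlt
  obtain ⟨c, hc, hpc, hcl⟩ := hj
  have : (phi m p) ∘ c = p ∘ c := by
    funext r
    simp only [Function.comp, phi_apply]
    rw [revPerm_lt]
    have := hc.monotone (Fin.le_last r)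
    rw [hcl, Fin.le_def] at this
    omega
  rw [this] at hpc
  have := firstBad_le m p (t := j) (Or.inr ⟨j.2, c, hc, hpc, hcl⟩)
  omega

lemma firstBad_phi {m n : ℕ} {p : Equiv.Perm (Fin n)}
    (hp : AvoidsSet p (Aki (m + 3) (m + 3 - 1))) : firstBad m (phi m p) = firstBad m p := by
  apply le_antisymm
  · apply firstBad_le
    rcases firstBad_mem m p with h0 | ⟨hlt, c, hc, hpc, hcl⟩
    · exact Or.inl h0
    · refine Or.inr ⟨hlt, c, hc, ?_, hcl⟩
      set a := firstBad m p with ha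
      have hrl : ((revPerm n a ⟨a, hlt⟩ : Fin n) : ℕ) = n - 1 := by
        rw [revPerm_ge (by simp)]
        simp
      have hx : p (c (Fin.last m).castSucc) < p (revPerm n a ⟨a, hlt⟩) := by
        rcases Nat.lt_or_ge a (n - 1) with h | h
        · apply (key hp hc hpc _).1
          rw [hcl, Fin.lt_def, hrl]
          exact h
        · have : revPerm n a ⟨a, hlt⟩ = c (Fin.last (m + 1)) := by
            rw [hcl]
            apply Fin.ext
            rw [hrl]
            simp
            omega
          rw [this]
          exact hpc (by simp [Fin.lt_def])
      have u := update_strictMono hpc hx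
      convert u using 1
      funext r
      by_cases hr : r = Fin.last (m + 1)
      · subst hr
        simp [phi_apply, hcl, ← ha]
      · rw [Function.update_of_ne hr]
        simp only [Function.comp, phi_apply]
        rw [revPerm_lt]
        have := hc (lt_of_le_of_ne (Fin.le_last r) hr)
        rw [hcl, Fin.lt_def] at this
        exact this
  · rcases firstBad_mem m (phi m p) with h0 | ⟨hlt, hb⟩
    · rw [h0]
      exact firstBad_le m p (Or.inl rfl)
    · exact bad_of_phi hb

lemma phi_avoids {m n : ℕ} {p : Equiv.Perm (Fin n)}
    (hp : AvoidsSet p (Aki (m + 3) (m + 3 - 1))) :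
    AvoidsSet (phi m p) (Aki (m + 3) (m + 3)) := by
  rintro q ⟨hA, hl⟩ ⟨f, hf, hfq⟩
  have hl' := hl (Fin.last (m + 2)) (by simp)
  have hnlt : ¬ q (Fin.last (m + 1)).castSucc < q (Fin.last (m + 2)) := by
    intro h
    apply hl'
    rw [last_of_lt hA h]
    omega
  rw [hfq] at hnlt
  have hb : BadPos m (phi m p) (f (Fin.last (m + 1)).castSucc) := by
    refine ⟨f ∘ Fin.castSucc, hf.comp (Fin.strictMono_castSucc), ?_, rfl⟩
    intro r s hrs
    refine (hfq _ _).1 (hA _ _ ?_ ?_)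
    · exact hrs
    · simp
  have h1 := bad_of_phi hb
  have h2 : f (Fin.last (m + 1)).castSucc < f (Fin.last (m + 2)) := hf (by simp [Fin.lt_def])
  rw [Fin.lt_def] at h2
  apply hnlt
  rw [phi_apply, phi_apply]
  have b := (f (Fin.last (m + 2))).2
  apply dec hp
  · rw [revPerm_ge (by omega)]
    omega
  · rw [Fin.lt_def, revPerm_ge (by omega), revPerm_ge (by omega)]
    omega

/-- `av_n(A_{k,k-1}) ≤ av_n(A_{k,k})` for every `n`. -/
theorem stmt11 (k n : ℕ) (hk : 3 ≤ k) (hn : 1 ≤ n) :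
    avSet n (Aki k (k - 1)) ≤ avSet n (Aki k k) := by
  obtain ⟨m, rfl⟩ : ∃ m, k = m + 3 := ⟨k - 3, by omega⟩
  unfold avSet
  refine Nat.card_le_card_of_injective
    (fun p : { p : Equiv.Perm (Fin n) // AvoidsSet p (Aki (m + 3) (m + 3 - 1)) } =>
      (⟨phi m p.1, phi_avoids p.2⟩ :
        { p : Equiv.Perm (Fin n) // AvoidsSet p (Aki (m + 3) (m + 3)) })) ?_
  rintro ⟨p, hp⟩ ⟨p', hp'⟩ h
  have h : phi m p = phi m p' := congrArg Subtype.val h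
  have e : firstBad m p = firstBad m p' := by
    rw [← firstBad_phi hp, ← firstBad_phi hp', h]
  apply Subtype.ext
  apply Equiv.ext
  intro i
  have := congrArg (fun s : Equiv.Perm (Fin n) => s ((revPerm n (firstBad m p)).symm i)) h
  simp only [phi_apply] at this
  rw [← e] at this
  simpa using this
end
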